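/- Let K be a field, S = K[x_1,...,x_ℓ] with the standard grading, R = K[x_1,...,x_n] ⊆ S for n ≤ ℓ, J a homogeneous ideal of S, and I = J ∩ R. Then reg(I) ≤ reg(Lex(J)), where Lex(J) is the lexicographic ideal of J. -/

import Mathlib

open MvPolynomial

variable {K : Type} [Field K]

/-- The degree-`k` homogeneous component of a homogeneous ideal `I`,
as a `K`-vector subspace of the polynomial ring (zero in negative degrees). -/
noncomputable def idealPiece {n : ℕ} (I : Ideal (MvPolynomial (Fin n) K)) (k : ℤ) :
    Submodule K (MvPolynomial (Fin n) K) :=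
  if 0 ≤ k then
    (Submodule.restrictScalars K (I : Submodule (MvPolynomial (Fin n) K) (MvPolynomial (Fin n) K)))
      ⊓ (homogeneousSubmodule (Fin n) K k.toNat)
  else ⊥

lemma mul_X_mem_idealPiece {n : ℕ} (I : Ideal (MvPolynomial (Fin n) K)) (t : Fin n) (k : ℤ)
    {x : MvPolynomial (Fin n) K} (hx : x ∈ idealPiece I k) :
    (X t : MvPolynomial (Fin n) K) * x ∈ idealPiece I (k + 1) := by
  by_cases h : 0 ≤ k
  · rw [idealPiece, if_pos h] at hx
    rw [idealPiece, if_pos (by omega)]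
    refine ⟨I.mul_mem_left _ hx.1, ?_⟩
    rw [Submodule.mem_inf] at hx
    have hh : x.IsHomogeneous k.toNat := (mem_homogeneousSubmodule _ _).1 hx.2
    have : ((X t : MvPolynomial (Fin n) K) * x).IsHomogeneous (1 + k.toNat) :=
      (isHomogeneous_X K t).mul hh
    have he : (k + 1).toNat = 1 + k.toNat := by omega
    exact (mem_homogeneousSubmodule _ _).2 (he ▸ this)
  · rw [idealPiece, if_neg h, Submodule.mem_bot] at hx
    rw [hx, mul_zero]
    exact Submodule.zero_mem _

/-- Multiplication by the variable `X t` as a linear map between graded pieces. -/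
noncomputable def mulXPiece {n : ℕ} (I : Ideal (MvPolynomial (Fin n) K)) (t : Fin n) (k : ℤ) :
    idealPiece I k →ₗ[K] idealPiece I (k + 1) :=
  (LinearMap.mulLeft K (X t)).restrict (fun _ hx => mul_X_mem_idealPiece I t k hx)

/-- Index set of the `i`-th term of the Koszul complex: subsets of the variables of size `i`. -/
abbrev KoszulIdx (n i : ℕ) := {s : Finset (Fin n) // s.card = i}

/-- The Koszul differential (in internal degree `j`) of the complex computing
`Tor(I, K)`, from homological degree `i+1` to homological degree `i`. -/
noncomputable def koszulDiff {n : ℕ} (I : Ideal (MvPolynomial (Fin n) K)) (i : ℕ) (j : ℤ) :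
    ((KoszulIdx n (i + 1)) → idealPiece I (j - (i + 1 : ℕ)))
      →ₗ[K] ((KoszulIdx n i) → idealPiece I (j - (i : ℕ))) :=
  ∑ s' : KoszulIdx n (i + 1), ∑ t ∈ (s' : Finset (Fin n)).attach,
    ((-1 : K) ^ (((s' : Finset (Fin n)).filter (fun u => u < t.1)).card)) •
      ((LinearMap.single (R := K) (φ := fun _ : KoszulIdx n i => idealPiece I (j - (i : ℕ)))
          ⟨(s' : Finset (Fin n)).erase t.1, by
            rw [Finset.card_erase_of_mem t.2, s'.2]; rfl⟩) ∘ₗ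
        (LinearEquiv.ofEq _ _ (by rw [show j - ((i : ℕ) + 1 : ℕ) + 1 = j - (i : ℕ) by push_cast; ring])).toLinearMap ∘ₗ
        (mulXPiece I t.1 (j - ((i : ℕ) + 1 : ℕ))) ∘ₗ
        (LinearMap.proj s'))

/-- Cycles of the Koszul complex at homological degree `i`, internal degree `j`. -/
noncomputable def koszulCycles {n : ℕ} (I : Ideal (MvPolynomial (Fin n) K)) :
    (i : ℕ) → (j : ℤ) → Submodule K ((KoszulIdx n i) → idealPiece I (j - (i : ℕ)))
  | 0, _ => ⊤
  | (i + 1), j => LinearMap.ker (koszulDiff I i j)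

set_option synthInstance.maxHeartbeats 1000000 in
set_option maxHeartbeats 1000000 in
/-- The graded Betti number `β_{i,j}(I) = dim_K Tor_i(I, K)_j`, computed as the dimension
of the homology of the Koszul complex (all spaces involved are finite-dimensional, so the
dimension of the homology `Z/B` is `dim Z - dim (B ⊓ Z)`). -/
noncomputable def gradedBetti {n : ℕ} (I : Ideal (MvPolynomial (Fin n) K)) (i : ℕ) (j : ℤ) : ℕ :=
  Module.finrank K ↥(koszulCycles I i j) -
    Module.finrank K ↥(LinearMap.range (koszulDiff I i j) ⊓ koszulCycles I i j)

/-- The Castelnuovo–Mumford regularity `reg(I) = max { j - i : β_{i,j}(I) ≠ 0 }`. -/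
noncomputable def reg {n : ℕ} (I : Ideal (MvPolynomial (Fin n) K)) : ℤ :=
  sSup {r : ℤ | ∃ (i : ℕ) (j : ℤ), gradedBetti I i j ≠ 0 ∧ r = j - i}

/-- `t_i(I) = max { j : β_{i,j}(I) ≠ 0 }`, the maximal shift in homological degree `i`. -/
noncomputable def maxShift {n : ℕ} (I : Ideal (MvPolynomial (Fin n) K)) (i : ℕ) : ℤ :=
  sSup {j : ℤ | gradedBetti I i j ≠ 0}

/-- The projective dimension of `I`. -/
noncomputable def projdim {n : ℕ} (I : Ideal (MvPolynomial (Fin n) K)) : ℕ :=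
  sSup {i : ℕ | ∃ j : ℤ, gradedBetti I i j ≠ 0}

/-- An ideal of a polynomial ring is homogeneous (for the standard grading) if it contains
all homogeneous components of its elements. -/
def IsHomogeneousIdeal {n : ℕ} (I : Ideal (MvPolynomial (Fin n) K)) : Prop :=
  ∀ f ∈ I, ∀ k : ℕ, homogeneousComponent k f ∈ I

/-- The lexicographic order on exponent vectors of monomials in `x_1,…,x_ℓ` with
`x_ℓ > x_{ℓ-1} > … > x_1` : `v < w` iff `w` beats `v` at the largest index where they differ. -/
def LexLT {ℓ : ℕ} (v w : Fin ℓ →₀ ℕ) : Prop :=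
  ∃ i : Fin ℓ, v i < w i ∧ ∀ j : Fin ℓ, i < j → v j = w j

/-- The lexicographic ideal `Lex(J)` of a homogeneous ideal `J`: in each degree `k` it is
spanned by the `dim_K J_k` largest monomials of degree `k` in the lexicographic order.
A monomial `x^v` of degree `k` is among the `N` largest ones exactly when the number of
monomials of degree `k` that are `≥ x^v` is at most `N`. -/
noncomputable def LexIdeal {ℓ : ℕ} (J : Ideal (MvPolynomial (Fin ℓ) K)) :
    Ideal (MvPolynomial (Fin ℓ) K) :=
  Ideal.span { p | ∃ v : Fin ℓ →₀ ℕ,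
    Set.ncard {w : Fin ℓ →₀ ℕ | (∑ i, w i) = (∑ i, v i) ∧ (v = w ∨ LexLT v w)} ≤
      Module.finrank K ↥(idealPiece J ((∑ i, v i : ℕ) : ℤ)) ∧ p = monomial v (1 : K) }

open scoped Classical in
/-- The exponent vectors of the monomials of degree `d` in `n` variables. -/
noncomputable def exponents (n d : ℕ) : Finset (Fin n →₀ ℕ) :=
  Finset.finsuppAntidiag Finset.univ d

lemma mem_exponents {n d : ℕ} {v : Fin n →₀ ℕ} : v ∈ exponents n d ↔ ∑ i, v i = d := by
  simp [exponents]

lemma sum_add_single {n : ℕ} (v : Fin n →₀ ℕ) (t : Fin n) :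
    ∑ i, (v + Finsupp.single t 1 : Fin n →₀ ℕ) i = ∑ i, v i + 1 := by
  simp [Finset.sum_add_distrib, Finsupp.single_apply]

lemma sum_cons {n : ℕ} (a : ℕ) (v : Fin n →₀ ℕ) : ∑ i, Finsupp.cons a v i = a + ∑ i, v i := by
  simp [Fin.sum_univ_succ]

lemma lexLT_iff {n : ℕ} {v w : Fin n →₀ ℕ} :
    LexLT v w ↔ toColex (v : Fin n → ℕ) < toColex (w : Fin n → ℕ) := by
  constructor
  · rintro ⟨i, h1, h2⟩
    exact ⟨i, fun j hj => h2 j hj, h1⟩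
  · rintro ⟨i, h1, h2⟩
    exact ⟨i, h2, fun j hj => h1 j hj⟩

namespace LexLT

variable {n : ℕ} {u v w : Fin n →₀ ℕ}

lemma irrefl (v : Fin n →₀ ℕ) : ¬ LexLT v v := by
  rw [lexLT_iff]
  exact lt_irrefl _

lemma trans (h₁ : LexLT u v) (h₂ : LexLT v w) : LexLT u w := by
  rw [lexLT_iff] at *
  exact h₁.trans h₂

lemma asymm (h₁ : LexLT u v) : ¬ LexLT v u := fun h₂ => irrefl _ (h₁.trans h₂)

lemma trichotomy (v w : Fin n →₀ ℕ) : LexLT v w ∨ v = w ∨ LexLT w v := by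
  rw [lexLT_iff, lexLT_iff]
  rcases lt_trichotomy (toColex (v : Fin n → ℕ)) (toColex (w : Fin n → ℕ)) with h | h | h
  · exact Or.inl h
  · exact Or.inr (Or.inl (DFunLike.coe_injective (toColex.injective h)))
  · exact Or.inr (Or.inr h)

lemma add_right (h : LexLT v w) (u : Fin n →₀ ℕ) : LexLT (v + u) (w + u) := by
  obtain ⟨i, h1, h2⟩ := h
  exact ⟨i, by simpa using h1, fun j hj => by simp [h2 j hj]⟩

lemma add_left (h : LexLT v w) (u : Fin n →₀ ℕ) : LexLT (u + v) (u + w) := by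
  simpa [add_comm] using h.add_right u

lemma single {s t : Fin n} (h : s < t) : LexLT (Finsupp.single s 1) (Finsupp.single t 1) :=
  ⟨t, by simp [h.ne], fun j hj => by simp [hj.ne, (h.trans hj).ne]⟩

lemma cons (h : LexLT v w) (a b : ℕ) : LexLT (Finsupp.cons a v) (Finsupp.cons b w) := by
  obtain ⟨i, h1, h2⟩ := h
  refine ⟨i.succ, by simpa using h1, fun j hj => ?_⟩
  obtain ⟨j, rfl⟩ := Fin.exists_succ_eq.2 (Fin.ne_zero_of_lt hj)
  simpa using h2 j (by simpa using hj)

lemma of_le {i : Fin n} (h : v i < w i) (h' : ∀ j, i < j → v j ≤ w j) : LexLT v w := by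
  rcases trichotomy v w with h1 | h1 | ⟨k, h1, h2⟩
  · exact h1
  · simp [h1] at h
  · rcases lt_trichotomy i k with hk | hk | hk
    · exact absurd (h' k hk) (by omega)
    · subst hk; omega
    · have := h2 i hk; omega

/-- Two vectors with the same sum, the smaller one first: the smaller one has an entry below
the place where they differ. -/
lemma exists_lt_of_sum_eq (h : ∑ i, v i = ∑ i, w i) {i : Fin n} (hi : v i < w i)
    (h' : ∀ j, i < j → v j = w j) : ∃ j < i, v j ≠ 0 := by
  by_contra! hc
  refine (Finset.sum_lt_sum (s := Finset.univ) (f := v) (g := w) ?_ ⟨i, Finset.mem_univ _, hi⟩).ne h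
  intro j _
  rcases lt_trichotomy j i with hj | hj | hj
  · simp [hc j hj]
  · subst hj; exact hi.le
  · exact (h' j hj).le

end LexLT

/-- A set of exponent vectors of degree `d` containing, with each of its elements, all larger
exponent vectors of degree `d`. -/
def IsLexSegment {n : ℕ} (d : ℕ) (L : Finset (Fin n →₀ ℕ)) : Prop :=
  L ⊆ exponents n d ∧ ∀ v ∈ L, ∀ w ∈ exponents n d, LexLT v w → w ∈ L

namespace IsLexSegment

variable {n d : ℕ} {L L' : Finset (Fin n →₀ ℕ)}

lemma subset_or_subset (h : IsLexSegment d L) (h' : IsLexSegment d L') : L ⊆ L' ∨ L' ⊆ L := by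
  by_contra! hc
  obtain ⟨⟨v, hv, hv'⟩, ⟨w, hw, hw'⟩⟩ := And.imp Finset.not_subset.1 Finset.not_subset.1 hc
  rcases LexLT.trichotomy v w with h1 | h1 | h1
  · exact hw' (h.2 v hv w (h'.1 hw) h1)
  · exact hv' (h1 ▸ hw)
  · exact hv' (h'.2 w hw v (h.1 hv) h1)

lemma subset_of_card_le (h : IsLexSegment d L) (h' : IsLexSegment d L')
    (hc : L.card ≤ L'.card) : L ⊆ L' := by
  rcases h.subset_or_subset h' with h1 | h1
  · exact h1
  · exact (Finset.eq_of_subset_of_card_le h1 hc).ge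

open scoped Classical in
lemma union (h : IsLexSegment d L) (h' : IsLexSegment d L') : IsLexSegment d (L ∪ L') := by
  rcases h.subset_or_subset h' with h1 | h1
  · rwa [Finset.union_eq_right.2 h1]
  · rwa [Finset.union_eq_left.2 h1]

open scoped Classical in
lemma card_union_le_max (h : IsLexSegment d L) (h' : IsLexSegment d L') :
    (L ∪ L').card ≤ max L.card L'.card := by
  rcases h.subset_or_subset h' with h1 | h1
  · rw [Finset.union_eq_right.2 h1]; exact le_max_right _ _
  · rw [Finset.union_eq_left.2 h1]; exact le_max_left _ _

end IsLexSegment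

open scoped Classical in
/-- The exponent vectors of degree `d` that are at least `v`. -/
noncomputable def lexUpper {n : ℕ} (d : ℕ) (v : Fin n →₀ ℕ) : Finset (Fin n →₀ ℕ) :=
  (exponents n d).filter fun w => v = w ∨ LexLT v w

lemma mem_lexUpper {n d : ℕ} {v w : Fin n →₀ ℕ} :
    w ∈ lexUpper d v ↔ w ∈ exponents n d ∧ (v = w ∨ LexLT v w) := by
  simp [lexUpper]

lemma lexUpper_subset {n d : ℕ} {v w : Fin n →₀ ℕ} (h : LexLT v w) :
    lexUpper d w ⊆ lexUpper d v := by
  intro u hu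
  rw [mem_lexUpper] at *
  rcases hu with ⟨h1, rfl | h2⟩
  · exact ⟨h1, Or.inr h⟩
  · exact ⟨h1, Or.inr (h.trans h2)⟩

lemma isLexSegment_lexUpper {n : ℕ} (d : ℕ) (v : Fin n →₀ ℕ) :
    IsLexSegment d (lexUpper d v) := by
  refine ⟨fun w hw => (mem_lexUpper.1 hw).1, fun u hu w hw h => mem_lexUpper.2 ⟨hw, ?_⟩⟩
  rcases (mem_lexUpper.1 hu).2 with rfl | h'
  · exact Or.inr h
  · exact Or.inr (h'.trans h)

open scoped Classical in
/-- The set of the `N` largest exponent vectors of degree `d` in `n` variables. -/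
noncomputable def lexSegment (n d N : ℕ) : Finset (Fin n →₀ ℕ) :=
  (exponents n d).filter fun v => (lexUpper d v).card ≤ N

section lexSegment

variable {n d N : ℕ}

lemma mem_lexSegment {v : Fin n →₀ ℕ} :
    v ∈ lexSegment n d N ↔ v ∈ exponents n d ∧ (lexUpper d v).card ≤ N := by
  simp [lexSegment]

lemma isLexSegment_lexSegment (n d N : ℕ) : IsLexSegment d (lexSegment n d N) :=
  ⟨Finset.filter_subset _ _, fun _ hv _ hw h => mem_lexSegment.2
    ⟨hw, (Finset.card_le_card (lexUpper_subset h)).trans (mem_lexSegment.1 hv).2⟩⟩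

lemma lexSegment_mono {N' : ℕ} (h : N ≤ N') : lexSegment n d N ⊆ lexSegment n d N' :=
  fun _ hv => mem_lexSegment.2 ⟨(mem_lexSegment.1 hv).1, (mem_lexSegment.1 hv).2.trans h⟩

lemma IsLexSegment.lexUpper_subset_of_mem {L : Finset (Fin n →₀ ℕ)} (h : IsLexSegment d L)
    {v : Fin n →₀ ℕ} (hv : v ∈ L) : lexUpper d v ⊆ L := by
  intro w hw
  rcases mem_lexUpper.1 hw with ⟨h1, rfl | h2⟩
  · exact hv
  · exact h.2 v hv w h1 h2

lemma IsLexSegment.subset_lexSegment {L : Finset (Fin n →₀ ℕ)} (h : IsLexSegment d L)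
    (hN : L.card ≤ N) : L ⊆ lexSegment n d N := fun _ hv =>
  mem_lexSegment.2 ⟨h.1 hv, (Finset.card_le_card (h.lexUpper_subset_of_mem hv)).trans hN⟩

lemma IsLexSegment.lexSegment_card_eq {L : Finset (Fin n →₀ ℕ)} (h : IsLexSegment d L) :
    lexSegment n d L.card = L := by
  classical
  refine Finset.Subset.antisymm (fun v hv => ?_) (h.subset_lexSegment le_rfl)
  by_contra hvL
  have hsub : insert v L ⊆ lexUpper d v := by
    intro w hw
    have hv' := (mem_lexSegment.1 hv).1
    rcases Finset.mem_insert.1 hw with rfl | hw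
    · exact mem_lexUpper.2 ⟨hv', Or.inl rfl⟩
    · refine mem_lexUpper.2 ⟨h.1 hw, ?_⟩
      rcases LexLT.trichotomy v w with h1 | h1 | h1
      · exact Or.inr h1
      · exact Or.inl h1
      · exact absurd (h.2 w hw v hv' h1) hvL
  have := Finset.card_le_card hsub
  rw [Finset.card_insert_of_notMem hvL] at this
  have := (mem_lexSegment.1 hv).2
  omega

lemma exists_max_of_nonempty {s : Finset (Fin n →₀ ℕ)} (hs : s.Nonempty) :
    ∃ m ∈ s, ∀ v ∈ s, v = m ∨ LexLT v m := by
  obtain ⟨m, hm, h⟩ := s.exists_max_image (fun v => toColex (v : Fin n → ℕ)) hs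
  refine ⟨m, hm, fun v hv => ?_⟩
  rcases LexLT.trichotomy v m with h1 | h1 | h1
  · exact Or.inr h1
  · exact Or.inl h1
  · exact absurd (h v hv) (not_le.2 (lexLT_iff.1 h1))

/-- A lex segment can be enlarged by the next exponent vector. -/
lemma IsLexSegment.exists_next {L : Finset (Fin n →₀ ℕ)} (h : IsLexSegment d L)
    (hL : L.card < (exponents n d).card) :
    ∃ m ∈ exponents n d, m ∉ L ∧ ∀ v ∈ exponents n d, v ∈ L ↔ LexLT m v := by
  classical
  obtain ⟨m, hm, hmax⟩ := exists_max_of_nonempty (s := exponents n d \ L)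
    (by
      rw [← Finset.card_pos, Finset.card_sdiff_of_subset h.1]
      omega)
  rw [Finset.mem_sdiff] at hm
  refine ⟨m, hm.1, hm.2, fun v hv => ⟨fun hvL => ?_, fun hmv => ?_⟩⟩
  · rcases LexLT.trichotomy m v with h1 | h1 | h1
    · exact h1
    · exact absurd (h1 ▸ hvL) hm.2
    · exact absurd (h.2 v hvL m hm.1 h1) hm.2
  · by_contra hvL
    rcases hmax v (Finset.mem_sdiff.2 ⟨hv, hvL⟩) with h1 | h1
    · exact LexLT.irrefl _ (h1 ▸ hmv)
    · exact h1.asymm hmv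

lemma card_lexSegment_aux (n d N : ℕ) :
    (lexSegment n d N).card ≤ N ∧
      (N ≤ (exponents n d).card → (lexSegment n d N).card = N) := by
  classical
  induction N with
  | zero =>
    have : lexSegment n d 0 = ∅ := by
      rw [Finset.eq_empty_iff_forall_notMem]
      intro v hv
      rw [mem_lexSegment, Nat.le_zero, Finset.card_eq_zero] at hv
      exact absurd (mem_lexUpper.2 ⟨hv.1, Or.inl rfl⟩) (by rw [hv.2]; simp)
    simp [this]
  | succ N ih =>
    by_cases hN : (lexSegment n d N).card < (exponents n d).card
    · obtain ⟨m, hm, hmL, hv⟩ := (isLexSegment_lexSegment n d N).exists_next hN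
      have hcard : (lexSegment n d N).card = N := by
        refine (le_or_gt N (exponents n d).card).elim ih.2 fun h => ?_
        exact absurd (mem_lexSegment.2 ⟨hm, (Finset.card_le_card
          (isLexSegment_lexUpper d m).1).trans h.le⟩) hmL
      have hins : IsLexSegment d (insert m (lexSegment n d N)) := by
        refine ⟨Finset.insert_subset hm (isLexSegment_lexSegment n d N).1, fun v hv' w hw h => ?_⟩
        rcases Finset.mem_insert.1 hv' with rfl | hv'
        · exact Finset.mem_insert_of_mem ((hv w hw).2 h)
        · exact Finset.mem_insert_of_mem ((isLexSegment_lexSegment n d N).2 v hv' w hw h)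
      have h1 := hins.lexSegment_card_eq
      rw [Finset.card_insert_of_notMem hmL, hcard] at h1
      rw [h1, Finset.card_insert_of_notMem hmL, hcard]
      simp
    · have h1 : lexSegment n d N = exponents n d :=
        Finset.eq_of_subset_of_card_le (isLexSegment_lexSegment n d N).1 (not_lt.1 hN)
      have h2 : lexSegment n d (N + 1) = exponents n d :=
        Finset.Subset.antisymm (isLexSegment_lexSegment n d _).1
          (h1.ge.trans (lexSegment_mono (Nat.le_succ N)))
      have h3 := ih.1
      rw [h1] at h3
      rw [h2]
      exact ⟨by omega, by omega⟩

lemma card_lexSegment_le (n d N : ℕ) : (lexSegment n d N).card ≤ N :=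
  (card_lexSegment_aux n d N).1

lemma card_lexSegment (h : N ≤ (exponents n d).card) : (lexSegment n d N).card = N :=
  (card_lexSegment_aux n d N).2 h

end lexSegment

open scoped Classical in
/-- The exponents of the products of a variable with a monomial with exponent in `L`. -/
noncomputable def upperShadow {n : ℕ} (L : Finset (Fin n →₀ ℕ)) : Finset (Fin n →₀ ℕ) :=
  L.biUnion fun v => Finset.univ.image fun t => v + Finsupp.single t 1

section upperShadow

variable {n d : ℕ} {L L' : Finset (Fin n →₀ ℕ)}

lemma mem_upperShadow {w : Fin n →₀ ℕ} :
    w ∈ upperShadow L ↔ ∃ v ∈ L, ∃ t, v + Finsupp.single t 1 = w := by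
  simp [upperShadow]

lemma upperShadow_mono (h : L ⊆ L') : upperShadow L ⊆ upperShadow L' := by
  intro w hw
  obtain ⟨v, hv, t, rfl⟩ := mem_upperShadow.1 hw
  exact mem_upperShadow.2 ⟨v, h hv, t, rfl⟩

lemma upperShadow_subset (h : L ⊆ exponents n d) : upperShadow L ⊆ exponents n (d + 1) := by
  intro w hw
  obtain ⟨v, hv, t, rfl⟩ := mem_upperShadow.1 hw
  have := mem_exponents.1 (h hv)
  rw [mem_exponents, sum_add_single, this]

lemma exists_add_single {v : Fin n →₀ ℕ} {t : Fin n} (h : v t ≠ 0) :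
    ∃ u, u + Finsupp.single t 1 = v := by
  refine ⟨v - Finsupp.single t 1, tsub_add_cancel_of_le ?_⟩
  rw [Finsupp.single_le_iff]
  omega

lemma mem_exponents_of_add_single {v : Fin n →₀ ℕ} {t : Fin n}
    (h : v + Finsupp.single t 1 ∈ exponents n (d + 1)) : v ∈ exponents n d := by
  rw [mem_exponents, sum_add_single] at h
  rw [mem_exponents]
  omega

lemma exists_min_ne_zero {v : Fin n →₀ ℕ} (h : v ∈ exponents n (d + 1)) :
    ∃ t, v t ≠ 0 ∧ ∀ s < t, v s = 0 := by
  have hne : v.support.Nonempty := by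
    rw [Finset.nonempty_iff_ne_empty]
    intro h0
    rw [Finsupp.support_eq_empty] at h0
    subst h0
    simp [mem_exponents] at h
  refine ⟨v.support.min' hne, Finsupp.mem_support_iff.1 (v.support.min'_mem hne), fun s hs => ?_⟩
  by_contra hc
  exact absurd (v.support.min'_le s (Finsupp.mem_support_iff.2 hc)) (not_le.2 hs)

lemma IsLexSegment.upperShadow (h : IsLexSegment d L) :
    IsLexSegment (d + 1) (upperShadow L) := by
  refine ⟨upperShadow_subset h.1, fun u hu w hw huw => ?_⟩
  obtain ⟨v, hv, t, rfl⟩ := mem_upperShadow.1 hu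
  obtain ⟨s, hs, hs'⟩ := exists_min_ne_zero hw
  obtain ⟨w, rfl⟩ := exists_add_single hs
  have hwd := mem_exponents_of_add_single hw
  refine mem_upperShadow.2 ⟨w, ?_, s, rfl⟩
  rcases LexLT.trichotomy v w with h1 | rfl | ⟨i, h1, h2⟩
  · exact h.2 v hv w hwd h1
  · exact hv
  · exfalso
    obtain ⟨j, hj, hj'⟩ := LexLT.exists_lt_of_sum_eq
      ((mem_exponents.1 hwd).trans (mem_exponents.1 (h.1 hv)).symm) h1 h2
    have hsj : s ≤ j := by
      by_contra hc
      have := hs' j (not_le.1 hc)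
      simp at this
      omega
    refine huw.asymm (LexLT.of_le (i := i) ?_ fun k hk => ?_)
    · have : s ≠ i := (hsj.trans_lt hj).ne
      simp only [Finsupp.add_apply, Finsupp.single_eq_of_ne this.symm]
      omega
    · have : s ≠ k := ((hsj.trans_lt hj).trans hk).ne
      simp only [Finsupp.add_apply, Finsupp.single_eq_of_ne this.symm, h2 k hk]
      omega

end upperShadow

/-- The least possible dimension of `R₁V` for an `N`-dimensional space `V` of forms of degree `d`
in a polynomial ring `R` in `n` variables. -/
noncomputable def lexGrowth (n d N : ℕ) : ℕ := (upperShadow (lexSegment n d N)).card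

/-- The number of monomials not divisible by the smallest variable among the `N` largest monomials
of degree `d` in `n + 1` variables. -/
noncomputable def lexSection (n d N : ℕ) : ℕ :=
  ((lexSegment (n + 1) d N).filter fun v => v 0 = 0).card

lemma lexGrowth_mono (n d : ℕ) : Monotone (lexGrowth n d) := fun _ _ h =>
  Finset.card_le_card (upperShadow_mono (lexSegment_mono h))

lemma lexGrowth_zero_left (d N : ℕ) : lexGrowth 0 d N = 0 := by
  rw [lexGrowth, Finset.card_eq_zero, Finset.eq_empty_iff_forall_notMem]
  intro w hw
  obtain ⟨_, _, t, _⟩ := mem_upperShadow.1 hw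
  exact t.elim0

lemma lexSection_le (n d N : ℕ) : lexSection n d N ≤ N :=
  (Finset.card_filter_le _ _).trans (card_lexSegment_le _ _ _)

lemma lexSection_zero_left (d N : ℕ) : lexSection 0 (d + 1) N = 0 := by
  rw [lexSection, Finset.card_eq_zero, Finset.filter_eq_empty_iff]
  intro v hv h0
  have := mem_exponents.1 ((isLexSegment_lexSegment _ _ _).1 hv)
  simp [h0] at this

section tail

variable {n d : ℕ} {L : Finset (Fin (n + 1) →₀ ℕ)}

open scoped Classical in
/-- The exponents in `L` in which the smallest variable does not occur. -/
noncomputable def tailSection (L : Finset (Fin (n + 1) →₀ ℕ)) : Finset (Fin n →₀ ℕ) :=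
  (L.filter fun v => v 0 = 0).image Finsupp.tail

lemma mem_tailSection {v : Fin n →₀ ℕ} : v ∈ tailSection L ↔ Finsupp.cons 0 v ∈ L := by
  simp only [tailSection, Finset.mem_image, Finset.mem_filter]
  constructor
  · rintro ⟨w, ⟨h1, h2⟩, rfl⟩
    rwa [← h2, Finsupp.cons_tail]
  · intro h
    exact ⟨_, ⟨h, Finsupp.cons_zero _ _⟩, Finsupp.tail_cons _ _⟩

lemma card_tailSection : (tailSection L).card = (L.filter fun v => v 0 = 0).card := by
  refine Finset.card_image_of_injOn fun v hv w hw h => ?_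
  rw [Finset.mem_coe, Finset.mem_filter] at hv hw
  rw [← Finsupp.cons_tail v, ← Finsupp.cons_tail w, h, hv.2, hw.2]

lemma IsLexSegment.tailSection (h : IsLexSegment d L) : IsLexSegment d (tailSection L) := by
  refine ⟨fun v hv => ?_, fun v hv w hw hvw => ?_⟩
  · simpa [mem_exponents, sum_cons] using h.1 (mem_tailSection.1 hv)
  · refine mem_tailSection.2 (h.2 _ (mem_tailSection.1 hv) _ ?_ (hvw.cons 0 0))
    simpa [mem_exponents, sum_cons] using hw

lemma tailSection_lexSegment (n d N : ℕ) :
    tailSection (lexSegment (n + 1) d N) = lexSegment n d (lexSection n d N) := by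
  rw [lexSection, ← card_tailSection]
  exact ((isLexSegment_lexSegment _ _ _).tailSection.lexSegment_card_eq).symm

end tail

/-- The upper shadow of a lex segment consists of its multiples by the smallest variable, and of
the upper shadow of its section. -/
lemma lexGrowth_succ_le (n d N : ℕ) :
    lexGrowth (n + 1) d N ≤ N + lexGrowth n d (lexSection n d N) := by
  classical
  set L := lexSegment (n + 1) d N with hL
  have hseg : IsLexSegment d L := isLexSegment_lexSegment _ _ _
  have hsub : upperShadow L ⊆ L.image (fun v => v + Finsupp.single 0 1) ∪
      (upperShadow (tailSection L)).image (Finsupp.cons 0) := by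
    intro w hw
    obtain ⟨v, hv, t, rfl⟩ := mem_upperShadow.1 hw
    rw [Finset.mem_union]
    by_cases ht : t = 0
    · exact Or.inl (Finset.mem_image.2 ⟨v, hv, by rw [ht]⟩)
    by_cases hv0 : v 0 = 0
    · obtain ⟨t, rfl⟩ := Fin.exists_succ_eq.2 ht
      refine Or.inr (Finset.mem_image.2 ⟨v.tail + Finsupp.single t 1, mem_upperShadow.2
        ⟨v.tail, mem_tailSection.2 (by rwa [← hv0, Finsupp.cons_tail]), t, rfl⟩, ?_⟩)
      ext i
      refine Fin.cases ?_ (fun i => ?_) i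
      · simp [hv0]
      · simp [Finsupp.single_apply, Finsupp.tail_apply]
    · obtain ⟨u, rfl⟩ := exists_add_single hv0
      refine Or.inl (Finset.mem_image.2 ⟨u + Finsupp.single t 1, ?_, by
        rw [add_assoc, add_assoc, add_comm (Finsupp.single t 1)]⟩)
      refine hseg.2 _ hv _ ?_ ((LexLT.single (Fin.pos_iff_ne_zero.2 ht)).add_left u)
      have := mem_exponents.1 (hseg.1 hv)
      rw [sum_add_single] at this
      rw [mem_exponents, sum_add_single, this]
  calc lexGrowth (n + 1) d N ≤ _ := Finset.card_le_card hsub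
    _ ≤ _ := Finset.card_union_le _ _
    _ ≤ L.card + (upperShadow (tailSection L)).card :=
      add_le_add Finset.card_image_le Finset.card_image_le
    _ ≤ _ := by
      rw [hL, tailSection_lexSegment]
      exact add_le_add (card_lexSegment_le _ _ _) le_rfl

/-- The numerical inequality behind Green's hyperplane restriction theorem. -/
lemma lexSection_le_of_add_le {n d N s : ℕ}
    (h : lexSection (n + 1) d (N - s) + lexSection n (d + 1) s ≤ s) :
    lexSection (n + 1) (d + 1) N ≤ s := by
  classical
  by_contra! hs
  set T := tailSection (lexSegment (n + 2) (d + 1) N) with hT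
  have hTseg : IsLexSegment (d + 1) T := (isLexSegment_lexSegment _ _ _).tailSection
  have hTcard : s < T.card := by rwa [hT, card_tailSection]
  set A := lexSegment (n + 1) (d + 1) s with hA
  have hAcard : A.card = s := card_lexSegment (hTcard.le.trans (Finset.card_le_card hTseg.1))
  have hAseg : IsLexSegment (d + 1) A := isLexSegment_lexSegment _ _ _
  obtain ⟨l, hl, hlA, hlA'⟩ := hAseg.exists_next
    (hAcard.trans_lt (hTcard.trans_le (Finset.card_le_card hTseg.1)))
  have hAT : A ⊆ T := hAseg.subset_of_card_le hTseg (hAcard.trans_lt hTcard).le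
  have hlT : l ∈ T := by
    obtain ⟨m, hm, hmA⟩ := Finset.exists_mem_notMem_of_card_lt_card (hAcard.trans_lt hTcard)
    rcases LexLT.trichotomy m l with h1 | h1 | h1
    · exact hTseg.2 m hm l hl h1
    · exact h1 ▸ hm
    · exact absurd ((hlA' m (hTseg.1 hm)).2 h1) hmA
  obtain ⟨k, hk, hk'⟩ := exists_min_ne_zero hl
  obtain ⟨u, rfl⟩ := exists_add_single hk
  have hu : u ∈ exponents (n + 1) d := mem_exponents_of_add_single hl
  have hcu : Finsupp.cons 0 u ∈ exponents (n + 2) d := by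
    simpa [mem_exponents, sum_cons] using hu
  have hu' : ∀ j < k, u j = 0 := fun j hj => by
    have := hk' j hj
    simp at this
    exact this.1
  set B := lexUpper d (Finsupp.cons 0 u) with hB
  -- the multiples by the smallest variable of the elements larger than `u`
  have hBcard : B.card ≤ N - s := by
    have hsub : (B.erase (Finsupp.cons 0 u)).image (fun v => v + Finsupp.single 0 1) ∪
        (insert (u + Finsupp.single k 1) A).image (Finsupp.cons 0) ⊆
          lexSegment (n + 2) (d + 1) N := by
      refine Finset.union_subset (fun w hw => ?_) (fun w hw => ?_)
      · obtain ⟨v, hv, rfl⟩ := Finset.mem_image.1 hw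
        obtain ⟨hv1, hv2⟩ := Finset.mem_erase.1 hv
        obtain ⟨hv3, hv4⟩ := mem_lexUpper.1 hv2
        obtain ⟨i, hi, hi'⟩ := hv4.resolve_left hv1.symm
        have hki : k.succ < i := by
          by_contra hc
          refine (Finset.sum_lt_sum (s := Finset.univ) (f := Finsupp.cons 0 u) (g := v) ?_
            ⟨i, Finset.mem_univ _, hi⟩).ne ((mem_exponents.1 hcu).trans (mem_exponents.1 hv3).symm)
          intro j _
          rcases lt_trichotomy j i with hj | hj | hj
          · have hjk := hj.trans_le (not_lt.1 hc)
            clear hj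
            refine Fin.cases (fun _ => ?_) (fun j hjk => ?_) j hjk
            · simp
            · simp [hu' j (Fin.succ_lt_succ_iff.1 hjk)]
          · subst hj; exact hi.le
          · exact (hi' j hj).le
        refine (isLexSegment_lexSegment _ _ _).2 _ (mem_tailSection.1 hlT) _ ?_ ⟨i, ?_, fun j hj => ?_⟩
        · rw [mem_exponents, sum_add_single, mem_exponents.1 hv3]
        · obtain ⟨i, rfl⟩ := Fin.exists_succ_eq.2 (Fin.ne_zero_of_lt hki)
          have : i ≠ k := (Fin.succ_lt_succ_iff.1 hki).ne'
          simpa [Finsupp.single_eq_of_ne this] using hi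
        · obtain ⟨j, rfl⟩ := Fin.exists_succ_eq.2 (Fin.ne_zero_of_lt hj)
          have : j ≠ k := (Fin.succ_lt_succ_iff.1 (hki.trans hj)).ne'
          simpa [Finsupp.single_eq_of_ne this] using hi' _ hj
      · obtain ⟨v, hv, rfl⟩ := Finset.mem_image.1 hw
        rcases Finset.mem_insert.1 hv with rfl | hv
        · exact mem_tailSection.1 hlT
        · exact mem_tailSection.1 (hAT hv)
    have hdisj : Disjoint ((B.erase (Finsupp.cons 0 u)).image (fun v => v + Finsupp.single 0 1))
        ((insert (u + Finsupp.single k 1) A).image (Finsupp.cons 0)) := by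
      rw [Finset.disjoint_left]
      intro w hw hw'
      obtain ⟨v, -, rfl⟩ := Finset.mem_image.1 hw
      obtain ⟨v', -, hv'⟩ := Finset.mem_image.1 hw'
      have := DFunLike.congr_fun hv' 0
      simp at this
    have hmem : Finsupp.cons 0 u ∈ B := mem_lexUpper.2 ⟨hcu, Or.inl rfl⟩
    have hcard := (Finset.card_le_card hsub).trans (card_lexSegment_le _ _ _)
    rw [Finset.card_union_of_disjoint hdisj,
      Finset.card_image_of_injective _ (add_left_injective _),
      Finset.card_image_of_injective _ (Finsupp.cons_right_injective _),
      Finset.card_insert_of_notMem hlA, hAcard,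
      Finset.card_erase_of_mem hmem] at hcard
    omega
  have hB' : lexUpper d u ⊆ tailSection (lexSegment (n + 2) d (N - s)) := by
    intro v hv
    rw [mem_tailSection]
    refine (isLexSegment_lexUpper d _).subset_lexSegment hBcard (mem_lexUpper.2 ?_)
    obtain ⟨h1, h2⟩ := mem_lexUpper.1 hv
    refine ⟨by simpa [mem_exponents, sum_cons] using h1, ?_⟩
    rcases h2 with rfl | h2
    · exact Or.inl rfl
    · exact Or.inr (h2.cons 0 0)
  have hsec1 : (lexUpper d u).card ≤ lexSection (n + 1) d (N - s) := by
    rw [lexSection, ← card_tailSection]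
    exact Finset.card_le_card hB'
  have hsub : A.filter (fun v => ¬ v 0 = 0) ⊆
      ((lexUpper d u).erase u).image (fun v => v + Finsupp.single 0 1) := by
    intro a ha
    obtain ⟨ha1, ha2⟩ := Finset.mem_filter.1 ha
    obtain ⟨v, rfl⟩ := exists_add_single ha2
    have hla := (hlA' _ (hAseg.1 ha1)).1 ha1
    have huv : LexLT u v := by
      have h0k : u + Finsupp.single 0 1 = u + Finsupp.single k 1 ∨
          LexLT (u + Finsupp.single 0 1) (u + Finsupp.single k 1) := by
        rcases eq_or_ne 0 k with h0 | h0
        · exact Or.inl (by rw [h0])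
        · exact Or.inr ((LexLT.single (Fin.pos_iff_ne_zero.2 h0.symm)).add_left u)
      have hlt : LexLT (u + Finsupp.single 0 1) (v + Finsupp.single 0 1) := by
        rcases h0k with h0 | h0
        · rwa [h0]
        · exact h0.trans hla
      rcases LexLT.trichotomy u v with h1 | rfl | h1
      · exact h1
      · exact absurd hlt (LexLT.irrefl _)
      · exact absurd hlt (h1.add_right _).asymm
    refine Finset.mem_image.2 ⟨v, Finset.mem_erase.2 ⟨?_, mem_lexUpper.2
      ⟨mem_exponents_of_add_single (hAseg.1 ha1), Or.inr huv⟩⟩, rfl⟩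
    rintro rfl
    exact LexLT.irrefl _ huv
  have hcard := (Finset.card_le_card hsub).trans Finset.card_image_le
  rw [Finset.card_erase_of_mem (mem_lexUpper.2 ⟨hu, Or.inl rfl⟩)] at hcard
  have hpos : 0 < (lexUpper d u).card := Finset.card_pos.2 ⟨u, mem_lexUpper.2 ⟨hu, Or.inl rfl⟩⟩
  have hsplit := Finset.card_filter_add_card_filter_not (s := A) (fun v => v 0 = 0)
  have : (A.filter fun v => v 0 = 0).card = lexSection n (d + 1) s := rfl
  omega

section linearAlgebra

variable {E F : Type*} [AddCommGroup E] [Module K E] [AddCommGroup F] [Module K F]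
  [FiniteDimensional K E]

/-- The dimension of the kernel is upper semicontinuous on a line of linear maps. -/
lemma finite_setOf_finrank_ker_lt (A B : E →ₗ[K] F) :
    {t : K | Module.finrank K (LinearMap.ker A) <
      Module.finrank K (LinearMap.ker (A + t • B))}.Finite := by
  obtain ⟨C, hC⟩ := (LinearMap.ker A).exists_isCompl
  have hker : LinearMap.ker (A ∘ₗ C.subtype) = ⊥ := by
    rw [LinearMap.ker_eq_bot']
    intro x hx
    exact Subtype.ext (Submodule.disjoint_def.1 hC.disjoint _ (LinearMap.mem_ker.2 hx) x.2)
  obtain ⟨Q, hQ⟩ := LinearMap.exists_leftInverse_of_injective _ hker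
  let M : Module.End K C := Q ∘ₗ B ∘ₗ C.subtype
  refine ((Module.End.finite_hasEigenvalue M).preimage
    (f := fun t : K => -t⁻¹) (fun s _ t _ h => by simpa using h)).subset fun t ht => ?_
  have hlt : Module.finrank K E <
      Module.finrank K (LinearMap.ker (A + t • B)) + Module.finrank K C := by
    rw [← Submodule.finrank_add_eq_of_isCompl hC]
    exact Nat.add_lt_add_right ht _
  have hinf : LinearMap.ker (A + t • B) ⊓ C ≠ ⊥ := fun h0 => by
    have h1 := Submodule.finrank_sup_add_finrank_inf_eq (LinearMap.ker (A + t • B)) C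
    rw [h0, finrank_bot] at h1
    have h2 := Submodule.finrank_le (LinearMap.ker (A + t • B) ⊔ C)
    omega
  obtain ⟨v, hv, hv0⟩ := Submodule.exists_mem_ne_zero_of_ne_bot hinf
  have h1 : A v + t • B v = 0 := hv.1
  have h2 : (⟨v, hv.2⟩ : C) + t • M ⟨v, hv.2⟩ = 0 := by
    have := congrArg Q h1
    rw [map_add, map_smul, map_zero] at this
    rw [← this]
    congr 1
    exact (LinearMap.congr_fun hQ ⟨v, hv.2⟩).symm
  have ht0 : t ≠ 0 := by
    rintro rfl
    simp only [zero_smul, add_zero] at h2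
    exact hv0 (congrArg Subtype.val h2)
  refine Module.End.hasEigenvalue_of_hasEigenvector (x := ⟨v, hv.2⟩)
    (Module.End.hasEigenvector_iff.2 ⟨Module.End.mem_eigenspace_iff.2 ?_, fun h =>
      hv0 (congrArg Subtype.val h)⟩)
  rw [eq_comm, neg_smul, neg_eq_iff_add_eq_zero, ← smul_right_injective C ht0 |>.eq_iff]
  simpa [smul_smul, ht0] using h2

lemma finite_setOf_finrank_ker_lt' (A B : E →ₗ[K] F) (s : K) :
    {t : K | Module.finrank K (LinearMap.ker (A + s • B)) <
      Module.finrank K (LinearMap.ker (A + t • B))}.Finite := by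
  refine ((finite_setOf_finrank_ker_lt (A + s • B) B).preimage
    (f := fun t => t - s) (sub_left_injective.injOn)).subset fun t ht => ?_
  rw [Set.mem_preimage, Set.mem_ofPred_eq, add_assoc, ← add_smul, add_sub_cancel]
  exact ht

end linearAlgebra

lemma finite_setOf_add_smul_eq_zero {K E : Type*} [Field K] [AddCommGroup E] [Module K E]
    {h g : E} {s : K} (hs : h + s • g ≠ 0) :
    {t : K | h + t • g = 0}.Finite := by
  refine Set.Subsingleton.finite fun t ht t' ht' => ?_
  by_contra hne
  have h1 : (t - t') • g = 0 := by
    rw [sub_smul, ← add_sub_add_left_eq_sub _ _ h, (ht : h + t • g = 0), (ht' : h + t' • g = 0),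
      sub_zero]
  have h2 : g = 0 := (smul_eq_zero.1 h1).resolve_left (sub_ne_zero.2 hne)
  have h3 : h + t • g = 0 := ht
  rw [h2, smul_zero] at h3 hs
  exact hs h3

section colon

variable {n d : ℕ}

instance finiteDimensional_homogeneousSubmodule :
    FiniteDimensional K (homogeneousSubmodule (Fin n) K d) :=
  Module.Finite.iff_fg.2 (homogeneousSubmodule_fg _ _ _)

lemma finiteDimensional_of_le {V : Submodule K (MvPolynomial (Fin n) K)}
    (hV : V ≤ homogeneousSubmodule (Fin n) K d) : FiniteDimensional K V :=
  Submodule.finiteDimensional_of_le hV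

lemma homogeneousComponent_succ_mul {h : MvPolynomial (Fin n) K} (hh : h.IsHomogeneous 1)
    (p : MvPolynomial (Fin n) K) :
    homogeneousComponent (d + 1) (h * p) = h * homogeneousComponent d p := by
  conv_lhs => rw [← sum_homogeneousComponent p, Finset.mul_sum, map_sum]
  have : ∀ i, homogeneousComponent (d + 1) (h * homogeneousComponent i p) =
      if i = d then h * homogeneousComponent i p else 0 := fun i => by
    rw [homogeneousComponent_of_mem (m := d + 1) (n := 1 + i)
      ((mem_homogeneousSubmodule _ _).2 (hh.mul (homogeneousComponent_isHomogeneous i p)))]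
    congr 1
    rw [add_comm 1 i, Nat.add_right_cancel_iff]
    exact propext eq_comm
  rw [Finset.sum_congr rfl fun i _ => this i, Finset.sum_ite_eq']
  split_ifs with hd
  · rfl
  · rw [homogeneousComponent_eq_zero, mul_zero]
    simpa using hd

/-- The space `V : h` of the polynomials `f` with `h * f ∈ V`. -/
noncomputable def colonSpace (V : Submodule K (MvPolynomial (Fin n) K))
    (h : MvPolynomial (Fin n) K) : Submodule K (MvPolynomial (Fin n) K) :=
  V.comap (LinearMap.mulLeft K h)

variable {V : Submodule K (MvPolynomial (Fin n) K)} {h : MvPolynomial (Fin n) K}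

lemma mem_colonSpace {f : MvPolynomial (Fin n) K} : f ∈ colonSpace V h ↔ h * f ∈ V := Iff.rfl

lemma colonSpace_le (hV : V ≤ homogeneousSubmodule (Fin n) K (d + 1)) (hh : h.IsHomogeneous 1)
    (h0 : h ≠ 0) : colonSpace V h ≤ homogeneousSubmodule (Fin n) K d := by
  intro f hf
  have h1 := homogeneousComponent_succ_mul (d := d) hh f
  rw [homogeneousComponent_eq_self (hV (mem_colonSpace.1 hf))] at h1
  rw [mul_left_cancel₀ h0 h1]
  exact homogeneousComponent_mem _ _

lemma colonSpace_eq_bot (hV : V ≤ homogeneousSubmodule (Fin n) K 0) (hh : h.IsHomogeneous 1)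
    (h0 : h ≠ 0) : colonSpace V h = ⊥ := by
  rw [eq_bot_iff]
  intro f hf
  by_contra hf0
  have h1 : (h * f).totalDegree = 0 :=
    ((mem_homogeneousSubmodule _ _).1 (hV hf)).totalDegree (mul_ne_zero h0 hf0)
  rw [totalDegree_mul_of_isDomain h0 hf0, hh.totalDegree h0] at h1
  omega

lemma finiteDimensional_colonSpace [FiniteDimensional K V] (h0 : h ≠ 0) :
    FiniteDimensional K (colonSpace V h) := by
  have : FiniteDimensional K ((colonSpace V h).map (LinearMap.mulLeft K h)) :=
    Submodule.finiteDimensional_of_le (Submodule.map_comap_le _ _)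
  exact Module.Finite.equiv (Submodule.equivMapOfInjective (LinearMap.mulLeft K h)
    (mul_right_injective₀ h0) (colonSpace V h)).symm

lemma finrank_colonSpace_le [FiniteDimensional K V] (h0 : h ≠ 0) :
    Module.finrank K (colonSpace V h) ≤ Module.finrank K V := by
  have hinj : Function.Injective (LinearMap.mulLeft K h) := mul_right_injective₀ h0
  rw [(Submodule.equivMapOfInjective _ hinj _).finrank_eq]
  exact Submodule.finrank_mono (Submodule.map_comap_le _ _)

/-- The dimension of `V : h` is upper semicontinuous on a line of linear forms `h`. -/
lemma finite_setOf_finrank_colonSpace_lt (hV : V ≤ homogeneousSubmodule (Fin n) K d)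
    {h g : MvPolynomial (Fin n) K} (hh : h.IsHomogeneous 1) (hg : g.IsHomogeneous 1) {s : K}
    (hs : h + s • g ≠ 0) :
    {t : K | h + t • g = 0 ∨ Module.finrank K (colonSpace V (h + s • g)) <
      Module.finrank K (colonSpace V (h + t • g))}.Finite := by
  suffices H : {t : K | h + t • g ≠ 0 ∧ Module.finrank K (colonSpace V (h + s • g)) <
      Module.finrank K (colonSpace V (h + t • g))}.Finite from
    ((finite_setOf_add_smul_eq_zero hs).union H).subset fun t ht => by
      by_cases h0 : h + t • g = 0
      · exact Or.inl h0
      · exact Or.inr ⟨h0, ht.resolve_left h0⟩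
  have hhom : ∀ t : K, (h + t • g).IsHomogeneous 1 := fun t =>
    (homogeneousSubmodule (Fin n) K 1).add_mem hh ((homogeneousSubmodule (Fin n) K 1).smul_mem t hg)
  rcases d with - | d
  · refine Set.finite_empty.subset fun t ht => ?_
    obtain ⟨ht0, ht⟩ := ht
    rw [colonSpace_eq_bot hV (hhom _) hs, colonSpace_eq_bot hV (hhom _) ht0] at ht
    exact absurd ht (lt_irrefl _)
  let A : MvPolynomial (Fin n) K → (homogeneousSubmodule (Fin n) K d →ₗ[K] MvPolynomial (Fin n) K ⧸ V) :=
    fun f => V.mkQ ∘ₗ LinearMap.mulLeft K f ∘ₗ Submodule.subtype _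
  have hA : ∀ t : K, A h + t • A g = A (h + t • g) := fun t => by
    refine LinearMap.ext fun f => ?_
    simp [A, add_mul]
  have hker : ∀ t : K, h + t • g ≠ 0 → Module.finrank K (LinearMap.ker (A h + t • A g)) =
      Module.finrank K (colonSpace V (h + t • g)) := fun t ht => by
    have : (LinearMap.ker (A (h + t • g))).map (Submodule.subtype _) = colonSpace V (h + t • g) := by
      ext f
      rw [Submodule.mem_map]
      constructor
      · rintro ⟨x, hx, rfl⟩
        exact (Submodule.Quotient.mk_eq_zero V).1 hx
      · intro hf
        exact ⟨⟨f, colonSpace_le hV (hhom t) ht hf⟩, (Submodule.Quotient.mk_eq_zero V).2 hf, rfl⟩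
    rw [hA, ← this]
    exact (Submodule.equivMapOfInjective _ (Submodule.injective_subtype _) _).finrank_eq
  refine (finite_setOf_finrank_ker_lt' (A h) (A g) s).subset fun t ht => ?_
  rw [Set.mem_ofPred_eq, hker s hs, hker t ht.1]
  exact ht.2

end colon

/-- The linear form with coefficient vector `a`. -/
noncomputable def linearForm {n : ℕ} : (Fin n → K) →ₗ[K] MvPolynomial (Fin n) K :=
  Fintype.linearCombination K X

section hyperplane

variable {n d : ℕ}

lemma linearForm_apply (a : Fin n → K) : linearForm a = ∑ i, a i • (X i : MvPolynomial (Fin n) K) :=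
  Fintype.linearCombination_apply _ _ _

lemma isHomogeneous_linearForm (a : Fin n → K) : (linearForm a).IsHomogeneous 1 := by
  rw [linearForm_apply]
  exact (homogeneousSubmodule (Fin n) K 1).sum_mem fun i _ =>
    (homogeneousSubmodule (Fin n) K 1).smul_mem _ (isHomogeneous_X K i)

lemma linearForm_ne_zero {a : Fin n → K} (ha : a ≠ 0) : linearForm a ≠ 0 := by
  intro h
  refine ha (funext fun i => ?_)
  have := congrArg (coeff (Finsupp.single i 1)) h
  rw [linearForm_apply] at this
  simpa [coeff_sum, coeff_X, Finsupp.single_left_inj] using this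

/-- The restriction to the hyperplane `X p = ∑ i, μ i * X (p.succAbove i)`. -/
noncomputable def hyperplaneRestrict (p : Fin (n + 1)) (μ : Fin n → K) :
    MvPolynomial (Fin (n + 1)) K →ₐ[K] MvPolynomial (Fin n) K :=
  aeval (p.insertNth (linearForm μ) X)

variable (p : Fin (n + 1)) (μ : Fin n → K)

@[simp]
lemma hyperplaneRestrict_X_self : hyperplaneRestrict p μ (X p) = linearForm μ := by
  simp [hyperplaneRestrict]

@[simp]
lemma hyperplaneRestrict_X_succAbove (i : Fin n) :
    hyperplaneRestrict p μ (X (p.succAbove i)) = X i := by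
  simp [hyperplaneRestrict]

lemma hyperplaneRestrict_linearForm_insertNth (a : Fin n → K) :
    hyperplaneRestrict p μ (linearForm (p.insertNth 0 a)) = linearForm a := by
  simp [linearForm_apply, Fin.sum_univ_succAbove _ p]

lemma isHomogeneous_hyperplaneRestrict {f : MvPolynomial (Fin (n + 1)) K}
    (hf : f.IsHomogeneous d) : (hyperplaneRestrict p μ f).IsHomogeneous d := by
  have := hf.aeval (p.insertNth (linearForm μ) X) (n := 1) fun i => by
    rcases Fin.eq_self_or_eq_succAbove p i with rfl | ⟨i, rfl⟩
    · simpa using isHomogeneous_linearForm μ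
    · simpa using isHomogeneous_X K i
  rwa [one_mul] at this

/-- The coefficients of a solution of `linearForm a = 0` for `X p`. -/
noncomputable def hyperplaneCoeff (a : Fin (n + 1) → K) (i : Fin n) : K :=
  -(a p)⁻¹ * a (p.succAbove i)

variable {p} {a : Fin (n + 1) → K}

lemma hyperplaneRestrict_linearForm (ha : a p ≠ 0) :
    hyperplaneRestrict p (hyperplaneCoeff p a) (linearForm a) = 0 := by
  rw [linearForm_apply, Fin.sum_univ_succAbove _ p, map_add, map_sum]
  simp [linearForm_apply, hyperplaneCoeff, Finset.smul_sum, smul_smul, ha]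

lemma linearForm_dvd_of_hyperplaneRestrict_eq_zero (ha : a p ≠ 0)
    {f : MvPolynomial (Fin (n + 1)) K}
    (hf : hyperplaneRestrict p (hyperplaneCoeff p a) f = 0) : linearForm a ∣ f := by
  let q := Ideal.Quotient.mkₐ K (Ideal.span {linearForm a})
  have hq : (q.comp (rename p.succAbove)).comp (hyperplaneRestrict p (hyperplaneCoeff p a)) = q := by
    refine algHom_ext fun i => ?_
    rcases Fin.eq_self_or_eq_succAbove p i with rfl | ⟨j, rfl⟩
    · have h0 : q (linearForm a) = 0 :=
        Ideal.Quotient.eq_zero_iff_mem.2 (Ideal.mem_span_singleton_self _)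
      have h0' : a i • q (X i) + ∑ j, a (i.succAbove j) • q (X (i.succAbove j)) = 0 := by
        simpa only [linearForm_apply a, Fin.sum_univ_succAbove _ i, map_add, map_sum, map_smul]
          using h0
      have h1 : q (X i) = -(a i)⁻¹ • ∑ j, a (i.succAbove j) • q (X (i.succAbove j)) := by
        rw [← neg_eq_of_add_eq_zero_right h0', neg_smul_neg, smul_smul, inv_mul_cancel₀ ha, one_smul]
      rw [h1]
      simp [linearForm_apply, hyperplaneCoeff, Finset.smul_sum, smul_smul]
    · simp
  rw [← Ideal.mem_span_singleton, ← Ideal.Quotient.eq_zero_iff_mem]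
  change q f = 0
  rw [← hq]
  simp [hf]

/-- The image of a space of polynomials under restriction to the hyperplane `linearForm a = 0`. -/
noncomputable def hyperplaneSection (p : Fin (n + 1)) (μ : Fin n → K)
    (V : Submodule K (MvPolynomial (Fin (n + 1)) K)) : Submodule K (MvPolynomial (Fin n) K) :=
  V.map (hyperplaneRestrict p μ).toLinearMap

variable {V : Submodule K (MvPolynomial (Fin (n + 1)) K)}

lemma hyperplaneSection_le {μ : Fin n → K} (hV : V ≤ homogeneousSubmodule (Fin (n + 1)) K d) :
    hyperplaneSection p μ V ≤ homogeneousSubmodule (Fin n) K d := by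
  rintro _ ⟨f, hf, rfl⟩
  exact isHomogeneous_hyperplaneRestrict p μ (hV hf)

lemma finrank_eq_colonSpace_add_section [FiniteDimensional K V] (ha : a p ≠ 0) :
    Module.finrank K V = Module.finrank K (colonSpace V (linearForm a)) +
      Module.finrank K (hyperplaneSection p (hyperplaneCoeff p a) V) := by
  let g := (hyperplaneRestrict p (hyperplaneCoeff p a)).toLinearMap.domRestrict V
  have h1 := g.finrank_range_add_finrank_ker
  have h2 : LinearMap.range g = hyperplaneSection p (hyperplaneCoeff p a) V := by
    rw [LinearMap.range_domRestrict]; rfl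
  have hinj : Function.Injective (LinearMap.mulLeft K (linearForm a)) :=
    mul_right_injective₀ (linearForm_ne_zero fun h => ha (congrFun h p))
  have h3 : (LinearMap.ker g).map V.subtype =
      (colonSpace V (linearForm a)).map (LinearMap.mulLeft K (linearForm a)) := by
    ext f
    simp only [Submodule.mem_map]
    constructor
    · rintro ⟨f, hf, rfl⟩
      obtain ⟨q, hq⟩ := linearForm_dvd_of_hyperplaneRestrict_eq_zero ha hf
      exact ⟨q, mem_colonSpace.2 (hq ▸ f.2), hq.symm⟩
    · rintro ⟨f, hf, rfl⟩
      refine ⟨⟨_, hf⟩, ?_, rfl⟩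
      change hyperplaneRestrict _ _ (linearForm a * f) = 0
      rw [map_mul, hyperplaneRestrict_linearForm ha, zero_mul]
  rw [(Submodule.equivMapOfInjective _ hinj (colonSpace V (linearForm a))).finrank_eq, ← h3,
    ← (Submodule.equivMapOfInjective _ (Submodule.injective_subtype _) _).finrank_eq, ← h1, h2,
    add_comm]

/-- Restriction to a hyperplane bounds the dimension of `V : h`. -/
lemma finrank_colonSpace_le_add [FiniteDimensional K V] (ha : a p ≠ 0)
    {h : MvPolynomial (Fin (n + 1)) K}
    (h0 : h ≠ 0) (h0' : hyperplaneRestrict p (hyperplaneCoeff p a) h ≠ 0) :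
    Module.finrank K (colonSpace V h) ≤
      Module.finrank K (colonSpace (colonSpace V (linearForm a)) h) +
      Module.finrank K (colonSpace (hyperplaneSection p (hyperplaneCoeff p a) V)
        (hyperplaneRestrict p (hyperplaneCoeff p a) h)) := by
  have := finiteDimensional_colonSpace (V := V) h0
  rw [finrank_eq_colonSpace_add_section (V := colonSpace V h) ha]
  have hcomm : colonSpace (colonSpace V h) (linearForm a) =
      colonSpace (colonSpace V (linearForm a)) h := by
    ext f
    simp only [mem_colonSpace, mul_left_comm h]
  have : FiniteDimensional K (hyperplaneSection p (hyperplaneCoeff p a) V) :=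
    FiniteDimensional.of_surjective _
      ((hyperplaneRestrict p (hyperplaneCoeff p a)).toLinearMap.submoduleMap_surjective V)
  have := finiteDimensional_colonSpace (V := hyperplaneSection p (hyperplaneCoeff p a) V) h0'
  rw [hcomm]
  refine Nat.add_le_add_left (Submodule.finrank_mono ?_) _
  rintro _ ⟨f, hf, rfl⟩
  exact ⟨h * f, hf, map_mul (hyperplaneRestrict p (hyperplaneCoeff p a)) _ _⟩

/-- **Green's hyperplane restriction theorem**: a suitable hyperplane section of an
`N`-dimensional space of forms is at most as large as the section of the corresponding lex
segment. -/
theorem exists_finrank_colonSpace_add_lexSection_le [Infinite K] (n d : ℕ)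
    (V : Submodule K (MvPolynomial (Fin (n + 1)) K))
    (hV : V ≤ homogeneousSubmodule (Fin (n + 1)) K d) :
    ∃ a : Fin (n + 1) → K, a ≠ 0 ∧
      Module.finrank K (colonSpace V (linearForm a)) + lexSection n d (Module.finrank K V) ≤
        Module.finrank K V := by
  induction n generalizing d with
  | zero =>
    refine ⟨1, one_ne_zero, ?_⟩
    have := finiteDimensional_of_le hV
    rcases d with - | d
    · rw [colonSpace_eq_bot hV (isHomogeneous_linearForm _) (linearForm_ne_zero one_ne_zero),
        finrank_bot, zero_add]
      exact lexSection_le _ _ _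
    · rw [lexSection_zero_left, add_zero]
      exact finrank_colonSpace_le (linearForm_ne_zero one_ne_zero)
  | succ n ihn =>
    induction d generalizing V with
    | zero =>
      refine ⟨1, one_ne_zero, ?_⟩
      rw [colonSpace_eq_bot hV (isHomogeneous_linearForm _) (linearForm_ne_zero one_ne_zero),
        finrank_bot, zero_add]
      exact lexSection_le _ _ _
    | succ d ihd =>
      have := finiteDimensional_of_le hV
      obtain ⟨a, ha0, hmin⟩ : ∃ a : Fin (n + 2) → K, a ≠ 0 ∧ ∀ b : Fin (n + 2) → K, b ≠ 0 →
          Module.finrank K (colonSpace V (linearForm a)) ≤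
            Module.finrank K (colonSpace V (linearForm b)) := by
        let f := fun a : Fin (n + 2) → K => Module.finrank K (colonSpace V (linearForm a))
        exact ⟨Function.argminOn f {a | a ≠ 0} ⟨1, one_ne_zero⟩,
          Function.argminOn_mem f {a | a ≠ 0} _,
          fun b hb => not_lt.1 (Function.not_lt_argminOn f {a | a ≠ 0} hb)⟩
      refine ⟨a, ha0, ?_⟩
      obtain ⟨p, hp⟩ := Function.ne_iff.1 ha0
      set π := hyperplaneRestrict p (hyperplaneCoeff p a) with hπ
      set W := colonSpace V (linearForm a) with hWdef
      set Vs := hyperplaneSection p (hyperplaneCoeff p a) V with hVs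
      have hW : W ≤ homogeneousSubmodule (Fin (n + 2)) K d :=
        colonSpace_le hV (isHomogeneous_linearForm _) (linearForm_ne_zero ha0)
      have hVs' : Vs ≤ homogeneousSubmodule (Fin (n + 1)) K (d + 1) := hyperplaneSection_le hV
      obtain ⟨b, hb0, hb⟩ := ihd W hW
      obtain ⟨c, hc0, hc⟩ := ihn (d + 1) Vs hVs'
      have hrank : Module.finrank K V = Module.finrank K W + Module.finrank K Vs :=
        finrank_eq_colonSpace_add_section hp
      set c' : Fin (n + 2) → K := p.insertNth 0 c with hc'
      have hπc : π (linearForm c') = linearForm c :=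
        hyperplaneRestrict_linearForm_insertNth _ _ _
      have hc'0 : c' ≠ 0 := fun h => hc0 (funext fun i => by
        simpa [hc'] using congrFun h (p.succAbove i))
      set g := linearForm c' - linearForm b with hg
      have hghom : g.IsHomogeneous 1 :=
        (isHomogeneous_linearForm _).sub (isHomogeneous_linearForm _)
      have hb1 : linearForm b + (0 : K) • g = linearForm b := by rw [zero_smul, add_zero]
      have hc1 : π (linearForm b) + (1 : K) • π g = linearForm c := by
        rw [one_smul, ← map_add, hg, add_sub_cancel, hπc]
      have hfin := (finite_setOf_finrank_colonSpace_lt hW (isHomogeneous_linearForm b) hghom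
        (s := 0) (by rw [hb1]; exact linearForm_ne_zero hb0)).union
          (finite_setOf_finrank_colonSpace_lt hVs'
            (isHomogeneous_hyperplaneRestrict p (hyperplaneCoeff p a) (isHomogeneous_linearForm b))
            (isHomogeneous_hyperplaneRestrict p (hyperplaneCoeff p a) hghom)
            (s := 1) (by rw [← hπ, hc1]; exact linearForm_ne_zero hc0))
      obtain ⟨t, ht⟩ := hfin.exists_notMem
      simp only [← hπ, Set.mem_union, Set.mem_ofPred_eq, not_or, not_lt] at ht
      obtain ⟨⟨ht1, ht2⟩, ht3, ht4⟩ := ht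
      rw [hb1] at ht2
      rw [hc1, ← hπ] at ht4
      have ht' : linearForm b + t • g = linearForm (b + t • (c' - b)) := by
        simp [hg]
      have hbt : b + t • (c' - b) ≠ 0 := by
        intro h
        rw [ht', h, map_zero] at ht1
        exact ht1 rfl
      have hle := finrank_colonSpace_le_add (V := V) hp ht1 (by
        rwa [← hπ, map_add, map_smul])
      rw [← hπ, map_add, map_smul, ← hVs, ← hWdef] at hle
      have hmin' := hmin _ hbt
      rw [← ht'] at hmin'
      have hkey : lexSection (n + 1) d (Module.finrank K V - Module.finrank K Vs) +
          lexSection n (d + 1) (Module.finrank K Vs) ≤ Module.finrank K Vs := by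
        rw [hrank, Nat.add_sub_cancel]
        omega
      have := lexSection_le_of_add_le hkey
      omega

end hyperplane

section koszulOperators

variable {m : ℕ} {A : Type*} [CommRing A]

/-- The sign occurring when `t` is inserted into `s`. -/
def insertSign (t : Fin m) (s : Finset (Fin m)) : ℤ :=
  (-1) ^ (s.filter (· < t)).card

lemma insertSign_mul_self (t : Fin m) (s : Finset (Fin m)) :
    insertSign t s * insertSign t s = 1 := by
  rw [insertSign, ← mul_pow, neg_one_mul, neg_neg, one_pow]

lemma insertSign_insert_of_lt {t u : Fin m} {s : Finset (Fin m)} (h : u < t) (hu : u ∉ s) :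
    insertSign t (insert u s) = -insertSign t s := by
  rw [insertSign, Finset.filter_insert, if_pos h, Finset.card_insert_of_notMem (by simp [hu]),
    pow_succ, mul_neg_one, insertSign]

lemma insertSign_insert_of_le {t u : Fin m} {s : Finset (Fin m)} (h : t ≤ u) :
    insertSign t (insert u s) = insertSign t s := by
  rw [insertSign, Finset.filter_insert, if_neg (not_lt.2 h), insertSign]

lemma insertSign_comm {t u : Fin m} {s : Finset (Fin m)} (h : t ≠ u) (ht : t ∉ s) (hu : u ∉ s) :
    insertSign t s * insertSign u (insert t s) = -(insertSign u s * insertSign t (insert u s)) := by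
  rcases h.lt_or_gt with h | h
  · rw [insertSign_insert_of_lt h ht, insertSign_insert_of_le h.le]
    ring
  · rw [insertSign_insert_of_lt h hu, insertSign_insert_of_le h.le]
    ring

/-- Contraction with the basis vector `t` on the exterior algebra over `A`, whose elements are
given by their coordinates. -/
def extContract (t : Fin m) : (Finset (Fin m) → A) →ₗ[A] (Finset (Fin m) → A) where
  toFun z s := if t ∈ s then 0 else insertSign t s • z (insert t s)
  map_add' x y := by ext s; dsimp; split_ifs <;> simp
  map_smul' a x := by ext s; dsimp; split_ifs <;> simp [mul_left_comm]

/-- Exterior multiplication with the basis vector `t`. -/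
def extMul (t : Fin m) : (Finset (Fin m) → A) →ₗ[A] (Finset (Fin m) → A) where
  toFun z s := if t ∈ s then insertSign t s • z (s.erase t) else 0
  map_add' x y := by ext s; dsimp; split_ifs <;> simp
  map_smul' a x := by ext s; dsimp; split_ifs <;> simp [mul_left_comm]

lemma extContract_of_mem {t : Fin m} {s : Finset (Fin m)} (h : t ∈ s) (z : Finset (Fin m) → A) :
    extContract t z s = 0 := if_pos h

lemma extContract_of_notMem {t : Fin m} {s : Finset (Fin m)} (h : t ∉ s)
    (z : Finset (Fin m) → A) : extContract t z s = insertSign t s • z (insert t s) := if_neg h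

lemma extMul_insert {t : Fin m} {s : Finset (Fin m)} (h : t ∉ s) (z : Finset (Fin m) → A) :
    extMul t z (insert t s) = insertSign t s • z s := by
  change (if _ then _ else _) = _
  rw [if_pos (Finset.mem_insert_self _ _), Finset.erase_insert h, insertSign_insert_of_le le_rfl]

lemma extMul_of_notMem {t : Fin m} {s : Finset (Fin m)} (h : t ∉ s)
    (z : Finset (Fin m) → A) : extMul t z s = 0 := if_neg h

lemma extContract_extContract_self (t : Fin m) (z : Finset (Fin m) → A) :
    extContract t (extContract t z) = 0 := by
  ext s
  by_cases h : t ∈ s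
  · exact extContract_of_mem h _
  · rw [extContract_of_notMem h, extContract_of_mem (Finset.mem_insert_self _ _), smul_zero,
      Pi.zero_apply]

lemma extContract_comm (t u : Fin m) (z : Finset (Fin m) → A) :
    extContract t (extContract u z) = -extContract u (extContract t z) := by
  rcases eq_or_ne t u with rfl | h
  · rw [extContract_extContract_self, neg_zero]
  ext s
  rw [Pi.neg_apply]
  by_cases ht : t ∈ s
  · rw [extContract_of_mem ht]
    by_cases hu : u ∈ s
    · rw [extContract_of_mem hu, neg_zero]
    · rw [extContract_of_notMem hu, extContract_of_mem (Finset.mem_insert_of_mem ht), smul_zero,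
        neg_zero]
  · by_cases hu : u ∈ s
    · rw [extContract_of_mem hu, extContract_of_notMem ht,
        extContract_of_mem (Finset.mem_insert_of_mem hu), smul_zero, neg_zero]
    · rw [extContract_of_notMem ht, extContract_of_notMem hu,
        extContract_of_notMem (by simp [h.symm, hu]), extContract_of_notMem (by simp [h, ht]),
        smul_smul, smul_smul, insertSign_comm h ht hu, neg_smul, Finset.insert_comm]

lemma extContract_extMul_self (t : Fin m) (z : Finset (Fin m) → A) :
    extContract t (extMul t z) + extMul t (extContract t z) = z := by
  ext s
  rw [Pi.add_apply]
  by_cases h : t ∈ s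
  · rw [extContract_of_mem h, zero_add]
    obtain ⟨s, hs, rfl⟩ : ∃ s', t ∉ s' ∧ insert t s' = s :=
      ⟨s.erase t, Finset.notMem_erase _ _, Finset.insert_erase h⟩
    rw [extMul_insert hs, extContract_of_notMem hs, smul_smul, insertSign_mul_self, one_smul]
  · rw [extContract_of_notMem h, extMul_insert h, extMul_of_notMem h, add_zero, smul_smul,
      insertSign_mul_self, one_smul]

lemma extContract_extMul_of_ne {t u : Fin m} (h : t ≠ u) (z : Finset (Fin m) → A) :
    extContract t (extMul u z) + extMul u (extContract t z) = 0 := by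
  ext s
  rw [Pi.add_apply, Pi.zero_apply]
  by_cases hu : u ∈ s
  · obtain ⟨s, hs, rfl⟩ : ∃ s', u ∉ s' ∧ insert u s' = s :=
      ⟨s.erase u, Finset.notMem_erase _ _, Finset.insert_erase hu⟩
    rw [extMul_insert hs]
    by_cases ht : t ∈ s
    · rw [extContract_of_mem (Finset.mem_insert_of_mem ht), extContract_of_mem ht, smul_zero,
        add_zero]
    · rw [extContract_of_notMem (by simp [h, ht]), extContract_of_notMem ht, Finset.insert_comm,
        extMul_insert (by simp [h.symm, hs]), smul_smul, smul_smul, ← add_smul]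
      convert zero_smul ℤ _
      rcases h.lt_or_gt with h | h
      · rw [insertSign_insert_of_lt h ht, insertSign_insert_of_le h.le]
        ring
      · rw [insertSign_insert_of_lt h hs, insertSign_insert_of_le h.le]
        ring
  · rw [extMul_of_notMem hu, add_zero]
    by_cases ht : t ∈ s
    · rw [extContract_of_mem ht]
    · rw [extContract_of_notMem ht, extMul_of_notMem (by simp [h.symm, hu]), smul_zero]

/-- The Koszul differential for the elements `y t`. -/
def koszulMap (y : Fin m → A) : (Finset (Fin m) → A) →ₗ[A] (Finset (Fin m) → A) :=
  ∑ t, y t • extContract t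

lemma koszulMap_apply (y : Fin m → A) (z : Finset (Fin m) → A) :
    koszulMap y z = ∑ t, y t • extContract t z := by
  simp [koszulMap]

lemma koszulMap_extContract (y : Fin m → A) (t : Fin m) (z : Finset (Fin m) → A) :
    koszulMap y (extContract t z) = -extContract t (koszulMap y z) := by
  simp only [koszulMap_apply, map_sum, map_smul, ← Finset.sum_neg_distrib]
  exact Finset.sum_congr rfl fun u _ => by rw [extContract_comm, smul_neg]

lemma koszulMap_koszulMap (y : Fin m → A) (z : Finset (Fin m) → A) :
    koszulMap y (koszulMap y z) = 0 := by
  have : koszulMap y (koszulMap y z) =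
      ∑ x : Fin m × Fin m, (y x.1 * y x.2) • extContract x.2 (extContract x.1 z) := by
    simp only [koszulMap_apply, map_sum, map_smul, Fintype.sum_prod_type, Finset.smul_sum,
      smul_smul]
  rw [this]
  refine Finset.sum_involution (fun x _ => x.swap) (fun x _ => ?_) (fun x _ hx h => hx ?_)
    (fun _ _ => Finset.mem_univ _) (fun _ _ => Prod.swap_swap _)
  · rw [Prod.fst_swap, Prod.snd_swap, extContract_comm x.2 x.1, mul_comm (y x.2), smul_neg,
      neg_add_cancel]
  · have : x.2 = x.1 := congrArg Prod.fst h
    rw [this, extContract_extContract_self, smul_zero]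

lemma koszulMap_extMul (y : Fin m → A) (t : Fin m) (z : Finset (Fin m) → A) :
    koszulMap y (extMul t z) + extMul t (koszulMap y z) = y t • z := by
  simp only [koszulMap_apply, map_sum, map_smul, ← Finset.sum_add_distrib, ← smul_add]
  rw [Finset.sum_eq_single t (fun u _ hu => by rw [extContract_extMul_of_ne hu, smul_zero])
    (fun h => absurd (Finset.mem_univ _) h), extContract_extMul_self]

/-- A multiple `(∑ t, a t * y t) z` of a cycle `z` is a boundary. -/
lemma koszulMap_sum_extMul (y a : Fin m → A) {z : Finset (Fin m) → A} (hz : koszulMap y z = 0) :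
    koszulMap y (∑ t, a t • extMul t z) = (∑ t, a t * y t) • z := by
  rw [map_sum, Finset.sum_smul]
  refine Finset.sum_congr rfl fun t _ => ?_
  have := koszulMap_extMul y t z
  rw [hz, map_zero, add_zero] at this
  rw [map_smul, this, smul_smul]

lemma map_koszulMap {B : Type*} [CommRing B] (f : A →+* B) (y : Fin m → A)
    (z : Finset (Fin m) → A) :
    (fun s => f (koszulMap y z s)) = koszulMap (fun t => f (y t)) (fun s => f (z s)) := by
  ext s
  simp only [koszulMap_apply, Finset.sum_apply, Pi.smul_apply, map_sum, smul_eq_mul, map_mul]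
  refine Finset.sum_congr rfl fun t _ => ?_
  by_cases h : t ∈ s
  · rw [extContract_of_mem h, extContract_of_mem h, map_zero]
  · rw [extContract_of_notMem h, extContract_of_notMem h, map_zsmul]

end koszulOperators

section values

variable {m : ℕ} {A : Type*} [CommRing A] [Algebra K A] {V : Submodule K A}
  {z : Finset (Fin m) → A}

lemma zsmul_mem_of_mem {v : A} (k : ℤ) (hv : v ∈ V) : k • v ∈ V := V.toAddSubgroup.zsmul_mem hv k

lemma extContract_mem (hz : ∀ s, z s ∈ V) (t : Fin m) (s : Finset (Fin m)) :
    extContract t z s ∈ V := by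
  by_cases h : t ∈ s
  · rw [extContract_of_mem h]
    exact V.zero_mem
  · rw [extContract_of_notMem h]
    exact zsmul_mem_of_mem _ (hz _)

lemma extMul_mem (hz : ∀ s, z s ∈ V) (t : Fin m) (s : Finset (Fin m)) :
    extMul t z s ∈ V := by
  change (if _ then _ else _) ∈ V
  split_ifs
  · exact zsmul_mem_of_mem _ (hz _)
  · exact V.zero_mem

end values

section pivot

variable {n : ℕ} {A : Type*} [CommRing A] (p : Fin (n + 1))

/-- Restriction of the coordinates to the subsets that do not contain `p`. -/
def extRestrict (z : Finset (Fin (n + 1)) → A) (s : Finset (Fin n)) : A :=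
  z (s.map p.succAboveEmb)

/-- Extension of coordinates by zero to the subsets that contain `p`. -/
def extExtend (w : Finset (Fin n) → A) (s : Finset (Fin (n + 1))) : A :=
  if p ∈ s then 0 else w (Finset.univ.filter fun i => p.succAbove i ∈ s)

variable {p}

lemma extExtend_of_mem {s : Finset (Fin (n + 1))} (h : p ∈ s) (w : Finset (Fin n) → A) :
    extExtend p w s = 0 := if_pos h

lemma notMem_map_succAboveEmb (s : Finset (Fin n)) : p ∉ s.map p.succAboveEmb := by
  simp [Fin.succAbove_ne]

lemma exists_map_succAboveEmb_eq {s : Finset (Fin (n + 1))} (h : p ∉ s) :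
    ∃ s' : Finset (Fin n), s'.map p.succAboveEmb = s := by
  refine ⟨Finset.univ.filter fun i => p.succAbove i ∈ s, ?_⟩
  ext t
  rcases Fin.eq_self_or_eq_succAbove p t with rfl | ⟨i, rfl⟩
  · simp [h, Fin.succAbove_ne]
  · simp

lemma extExtend_map (w : Finset (Fin n) → A) (s : Finset (Fin n)) :
    extExtend p w (s.map p.succAboveEmb) = w s := by
  rw [extExtend, if_neg (notMem_map_succAboveEmb s)]
  congr 1
  ext i
  simp

lemma extExtend_extRestrict {z : Finset (Fin (n + 1)) → A} (hz : ∀ s, p ∈ s → z s = 0) :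
    extExtend p (extRestrict p z) = z := by
  ext s
  by_cases h : p ∈ s
  · rw [extExtend_of_mem h, hz s h]
  · obtain ⟨s, rfl⟩ := exists_map_succAboveEmb_eq h
    rw [extExtend_map, extRestrict]

lemma insertSign_map_succAboveEmb (i : Fin n) (s : Finset (Fin n)) :
    insertSign (p.succAbove i) (s.map p.succAboveEmb) = insertSign i s := by
  rw [insertSign, insertSign, Finset.filter_map, Finset.card_map]
  congr 2
  ext j
  rw [Finset.mem_filter, Finset.mem_filter]
  simp [Fin.succAbove_lt_succAbove_iff]

lemma extContract_succAbove_extExtend (w : Finset (Fin n) → A) (i : Fin n) :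
    extContract (p.succAbove i) (extExtend p w) = extExtend p (extContract i w) := by
  ext s
  by_cases h : p ∈ s
  · rw [extExtend_of_mem h]
    by_cases hi : p.succAbove i ∈ s
    · rw [extContract_of_mem hi]
    · rw [extContract_of_notMem hi, extExtend_of_mem (Finset.mem_insert_of_mem h), smul_zero]
  · obtain ⟨s, rfl⟩ := exists_map_succAboveEmb_eq h
    rw [extExtend_map]
    by_cases hi : i ∈ s
    · have hi' : p.succAbove i ∈ s.map p.succAboveEmb := by simpa using hi
      rw [extContract_of_mem hi, extContract_of_mem hi']
    · have hi' : p.succAbove i ∉ s.map p.succAboveEmb := by simpa using hi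
      rw [extContract_of_notMem hi, extContract_of_notMem hi', insertSign_map_succAboveEmb]
      have := Finset.map_insert p.succAboveEmb i s
      rw [Fin.coe_succAboveEmb] at this
      rw [← this, extExtend_map]

lemma extContract_extExtend (w : Finset (Fin n) → A) : extContract p (extExtend p w) = 0 := by
  ext s
  by_cases h : p ∈ s
  · exact extContract_of_mem h _
  · rw [extContract_of_notMem h, extExtend_of_mem (Finset.mem_insert_self _ _), smul_zero,
      Pi.zero_apply]

lemma koszulMap_extExtend (y : Fin (n + 1) → A) (w : Finset (Fin n) → A) :
    koszulMap y (extExtend p w) =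
      extExtend p (koszulMap (fun i => y (p.succAbove i)) w) := by
  rw [koszulMap_apply, Fin.sum_univ_succAbove _ p, extContract_extExtend, smul_zero, zero_add]
  simp only [extContract_succAbove_extExtend]
  ext s
  by_cases h : p ∈ s
  · simp [extExtend_of_mem h]
  · obtain ⟨s, rfl⟩ := exists_map_succAboveEmb_eq h
    simp [extExtend_map, koszulMap_apply]

lemma extExtend_injective : Function.Injective (extExtend p : _ → Finset (Fin (n + 1)) → A) := by
  intro w w' h
  ext s
  rw [← extExtend_map (p := p) w, h, extExtend_map]

lemma eq_zero_of_extContract_eq_zero {z : Finset (Fin (n + 1)) → A} (h : extContract p z = 0)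
    (s : Finset (Fin (n + 1))) (hs : p ∈ s) : z s = 0 := by
  have h1 := congrFun h (s.erase p)
  rw [extContract_of_notMem (Finset.notMem_erase _ _), Finset.insert_erase hs] at h1
  rw [← one_smul ℤ (z s), ← insertSign_mul_self p (s.erase p), mul_smul, h1, Pi.zero_apply,
    smul_zero]

variable [Algebra K A] {U V : Submodule K A}

lemma extExtend_mem {w : Finset (Fin n) → A} (hw : ∀ s, w s ∈ V) (s : Finset (Fin (n + 1))) :
    extExtend p w s ∈ V := by
  rw [extExtend]
  split_ifs
  · exact V.zero_mem
  · exact hw _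

/-- Cycles with values in `U` are boundaries of chains with values in `V`. -/
def KoszulExact {m : ℕ} (y : Fin m → A) (V U : Submodule K A) : Prop :=
  ∀ z : Finset (Fin m) → A, (∀ s, z s ∈ U) → koszulMap y z = 0 →
    ∃ w : Finset (Fin m) → A, (∀ s, w s ∈ V) ∧ koszulMap y w = z

/-- Exactness of the Koszul complex is not affected by adding a linearly dependent element. -/
lemma KoszulExact.of_pivot {y : Fin (n + 1) → A} (μ : Fin n → K)
    (hy : y p = ∑ i, μ i • y (p.succAbove i))
    (h : KoszulExact (fun i => y (p.succAbove i)) V U) : KoszulExact y V U := by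
  let c : (Finset (Fin (n + 1)) → A) → (Finset (Fin (n + 1)) → A) := fun z =>
    extMul p z - ∑ j, algebraMap K A (μ j) • extMul (p.succAbove j) z
  have hc : ∀ z, koszulMap y (c z) = -c (koszulMap y z) := fun z => by
    have h1 : ∀ t, koszulMap y (extMul t z) = y t • z - extMul t (koszulMap y z) := fun t =>
      eq_sub_of_add_eq (koszulMap_extMul y t z)
    simp only [c, map_sub, map_sum, map_smul, h1, smul_sub, Finset.sum_sub_distrib, smul_smul,
      ← Finset.sum_smul]
    simp only [hy, Algebra.smul_def]
    abel
  have hcp : ∀ z, extContract p z = 0 → extContract p (c z) = z := fun z hz => by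
    have h1 := extContract_extMul_self p z
    rw [hz, map_zero, add_zero] at h1
    have h2 : ∀ j, extContract p (extMul (p.succAbove j) z) = 0 := fun j => by
      have := extContract_extMul_of_ne (p.succAbove_ne j).symm z
      rwa [hz, map_zero, add_zero] at this
    simp only [c, map_sub, map_sum, map_smul, h1, h2, smul_zero, Finset.sum_const_zero, sub_zero]
  have hcV : ∀ W : Submodule K A, ∀ z, (∀ s, z s ∈ W) → ∀ s, c z s ∈ W := fun W z hz s => by
    simp only [c, Pi.sub_apply, Finset.sum_apply, Pi.smul_apply, algebraMap_smul]
    exact W.sub_mem (extMul_mem hz _ _) (W.sum_mem fun j _ => W.smul_mem _ (extMul_mem hz _ _))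
  have hker : ∀ z, (∀ s, z s ∈ U) → koszulMap y z = 0 → extContract p z = 0 →
      ∃ w, (∀ s, w s ∈ V) ∧ koszulMap y w = z := fun z hzU hz hzp => by
    have hz' := extExtend_extRestrict (eq_zero_of_extContract_eq_zero hzp)
    obtain ⟨w, hw, hwz⟩ := h (extRestrict p z) (fun s => hzU _) (extExtend_injective (p := p) (by
      rw [← koszulMap_extExtend, hz', hz]
      ext s
      simp [extExtend]))
    exact ⟨extExtend p w, extExtend_mem hw, by rw [koszulMap_extExtend, hwz, hz']⟩
  intro z hzU hz
  have hz1 : koszulMap y (extContract p z) = 0 := by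
    rw [koszulMap_extContract, hz, map_zero, neg_zero]
  have hz1p := extContract_extContract_self p z
  have hc0 : c 0 = 0 := by simp [c]
  obtain ⟨w1, hw1, hw1z⟩ := hker _ (extContract_mem hzU p) hz1 hz1p
  obtain ⟨w0, hw0, hw0z⟩ := hker (z - c (extContract p z))
    (fun s => U.sub_mem (hzU s) (hcV U _ (extContract_mem hzU p) s))
    (by rw [map_sub, hz, hc, hz1, hc0, neg_zero, sub_zero])
    (by rw [map_sub, hcp _ hz1p, sub_self])
  refine ⟨w0 - c w1, fun s => V.sub_mem (hw0 s) (hcV V _ hw1 s), ?_⟩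
  rw [map_sub, hw0z, hc, hw1z]
  abel

end pivot

section mulVars

variable {n d : ℕ}

/-- The space `R₁V` spanned by the products of the variables with the elements of `V`. -/
noncomputable def mulVars (V : Submodule K (MvPolynomial (Fin n) K)) :
    Submodule K (MvPolynomial (Fin n) K) :=
  ⨆ t, V.map (LinearMap.mulLeft K (X t))

variable {V : Submodule K (MvPolynomial (Fin n) K)}

lemma X_mul_mem_mulVars (t : Fin n) {f : MvPolynomial (Fin n) K} (hf : f ∈ V) :
    X t * f ∈ mulVars V :=
  Submodule.mem_iSup_of_mem t ⟨f, hf, rfl⟩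

lemma mulVars_le {W : Submodule K (MvPolynomial (Fin n) K)} (h : ∀ t, ∀ f ∈ V, X t * f ∈ W) :
    mulVars V ≤ W := by
  refine iSup_le fun t => ?_
  rintro _ ⟨f, hf, rfl⟩
  exact h t f hf

lemma mulVars_le_homogeneousSubmodule (hV : V ≤ homogeneousSubmodule (Fin n) K d) :
    mulVars V ≤ homogeneousSubmodule (Fin n) K (d + 1) :=
  mulVars_le fun t f hf => by
    rw [add_comm]
    exact (isHomogeneous_X K t).mul (hV hf)

lemma linearForm_mul_mem_mulVars (a : Fin n → K) {f : MvPolynomial (Fin n) K} (hf : f ∈ V) :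
    linearForm a * f ∈ mulVars V := by
  rw [linearForm_apply, Finset.sum_mul]
  refine Submodule.sum_mem _ fun t _ => ?_
  rw [smul_mul_assoc]
  exact Submodule.smul_mem _ _ (X_mul_mem_mulVars t hf)

lemma hyperplaneSection_mulVars (p : Fin (n + 1)) (μ : Fin n → K)
    (V : Submodule K (MvPolynomial (Fin (n + 1)) K)) :
    hyperplaneSection p μ (mulVars V) = mulVars (hyperplaneSection p μ V) := by
  refine le_antisymm ?_ (mulVars_le fun t f hf => ?_)
  · rw [hyperplaneSection, Submodule.map_le_iff_le_comap]
    refine mulVars_le fun t f hf => ?_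
    change hyperplaneRestrict p μ (X t * f) ∈ mulVars (hyperplaneSection p μ V)
    have hf' : hyperplaneRestrict p μ f ∈ hyperplaneSection p μ V := ⟨f, hf, rfl⟩
    rw [map_mul]
    rcases Fin.eq_self_or_eq_succAbove p t with rfl | ⟨i, rfl⟩
    · rw [hyperplaneRestrict_X_self]
      exact linearForm_mul_mem_mulVars _ hf'
    · rw [hyperplaneRestrict_X_succAbove]
      exact X_mul_mem_mulVars _ hf'
  · obtain ⟨f, hf : f ∈ V, rfl⟩ := hf
    refine ⟨X (p.succAbove t) * f, X_mul_mem_mulVars _ hf, ?_⟩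
    change hyperplaneRestrict p μ _ = _
    rw [map_mul, hyperplaneRestrict_X_succAbove]
    rfl

/-- Lifting the exactness of the Koszul complex from a hyperplane section. -/
lemma KoszulExact.of_hyperplaneSection {p : Fin (n + 1)} {a : Fin (n + 1) → K} (ha : a p ≠ 0)
    {V : Submodule K (MvPolynomial (Fin (n + 1)) K)}
    (hcolon : colonSpace (mulVars V) (linearForm a) ≤ V)
    (h : KoszulExact X (hyperplaneSection p (hyperplaneCoeff p a) V)
      (mulVars (hyperplaneSection p (hyperplaneCoeff p a) V))) :
    KoszulExact X V (mulVars V) := by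
  set μ := hyperplaneCoeff p a
  set π := hyperplaneRestrict p μ with hπ
  have hex : KoszulExact (fun t => π (X t)) (hyperplaneSection p μ V)
      (hyperplaneSection p μ (mulVars V)) := by
    refine KoszulExact.of_pivot (p := p) μ ?_ ?_
    · simp [hπ, linearForm_apply]
    · simpa [hπ, hyperplaneSection_mulVars] using h
  intro z hzU hz
  have hmap : ∀ w : Finset (Fin (n + 1)) → MvPolynomial (Fin (n + 1)) K,
      (fun s => π (koszulMap X w s)) = koszulMap (fun t => π (X t)) (fun s => π (w s)) :=
    fun w => map_koszulMap π.toRingHom X w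
  obtain ⟨w', hw', hw'z⟩ := hex (fun s => π (z s)) (fun s => ⟨z s, hzU s, rfl⟩) (by
    rw [← hmap, hz]
    ext1 s
    exact map_zero π)
  choose w hwV hww' using hw'
  have hdw : ∀ s, koszulMap X w s ∈ mulVars V := fun s => by
    rw [koszulMap_apply, Finset.sum_apply]
    exact Submodule.sum_mem _ fun t _ => X_mul_mem_mulVars t (extContract_mem hwV t s)
  have hdvd : ∀ s, ∃ y, z s - koszulMap X w s = linearForm a * y := fun s => by
    refine linearForm_dvd_of_hyperplaneRestrict_eq_zero ha ?_
    have h1 := congrFun (hmap w) s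
    have h2 : (fun s => π (w s)) = w' := funext hww'
    rw [h2, hw'z] at h1
    change π _ = 0
    rw [map_sub, h1, sub_self]
  choose y hy using hdvd
  have hyV : ∀ s, y s ∈ V := fun s =>
    hcolon (mem_colonSpace.2 (hy s ▸ Submodule.sub_mem _ (hzU s) (hdw s)))
  have hzy : z - koszulMap X w = linearForm a • y := funext hy
  have hl0 : linearForm a ≠ 0 := linearForm_ne_zero fun h0 => ha (congrFun h0 p)
  have hdy : koszulMap X y = 0 := by
    have h1 : linearForm a • koszulMap X y = 0 := by
      rw [← map_smul, ← hzy, map_sub, hz, koszulMap_koszulMap, sub_zero]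
    exact (smul_eq_zero.1 h1).resolve_left hl0
  refine ⟨w + ∑ t, (C (a t) : MvPolynomial (Fin (n + 1)) K) • extMul t y, fun s => ?_, ?_⟩
  · refine V.add_mem (hwV s) ?_
    rw [Finset.sum_apply]
    refine V.sum_mem fun t _ => ?_
    rw [Pi.smul_apply, smul_eq_mul, ← smul_eq_C_mul]
    exact V.smul_mem _ (extMul_mem hyV t s)
  · rw [map_add, koszulMap_sum_extMul X _ hdy]
    have : ∑ t, C (a t) * X t = linearForm a := by
      simp [linearForm_apply, smul_eq_C_mul]
    rw [this, ← hzy, add_sub_cancel]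

/-- Macaulay's bound on the growth of a space of forms, and the exactness of the Koszul complex in
case of minimal growth. -/
theorem lexGrowth_le_and_koszulExact_of_infinite [Infinite K] (n d : ℕ)
    (V : Submodule K (MvPolynomial (Fin n) K)) (hV : V ≤ homogeneousSubmodule (Fin n) K d) :
    lexGrowth n d (Module.finrank K V) ≤ Module.finrank K (mulVars V) ∧
      (Module.finrank K (mulVars V) ≤ lexGrowth n d (Module.finrank K V) →
        KoszulExact X V (mulVars V)) := by
  induction n with
  | zero =>
    have h0 : mulVars V = ⊥ := by
      rw [mulVars, iSup_of_empty]
    refine ⟨by rw [lexGrowth_zero_left]; exact Nat.zero_le _, fun _ z hz _ => ⟨0, ?_, ?_⟩⟩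
    · exact fun _ => V.zero_mem
    · rw [map_zero]
      ext1 s
      have := hz s
      rw [h0] at this
      exact ((Submodule.mem_bot K).1 this).symm
  | succ n ih =>
    have := finiteDimensional_of_le hV
    have hU := mulVars_le_homogeneousSubmodule hV
    have := finiteDimensional_of_le hU
    obtain ⟨a, ha0, ha⟩ := exists_finrank_colonSpace_add_lexSection_le n d V hV
    obtain ⟨p, hp⟩ := Function.ne_iff.1 ha0
    have hV' : V ≤ colonSpace (mulVars V) (linearForm a) := fun f hf =>
      linearForm_mul_mem_mulVars a hf
    have h1 := finrank_eq_colonSpace_add_section (V := V) hp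
    have h2 := finrank_eq_colonSpace_add_section (V := mulVars V) hp
    have := finiteDimensional_colonSpace (V := mulVars V) (linearForm_ne_zero ha0)
    have h3 := Submodule.finrank_mono hV'
    rw [hyperplaneSection_mulVars] at h2
    obtain ⟨h4, h5⟩ := ih (hyperplaneSection p (hyperplaneCoeff p a) V) (hyperplaneSection_le hV)
    have h6 := lexGrowth_succ_le n d (Module.finrank K V)
    have h7 : lexGrowth n d (lexSection n d (Module.finrank K V)) ≤
        lexGrowth n d (Module.finrank K (hyperplaneSection p (hyperplaneCoeff p a) V)) :=
      lexGrowth_mono n d (by omega)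
    refine ⟨by omega, fun hle => ?_⟩
    refine KoszulExact.of_hyperplaneSection hp ?_ (h5 (by omega))
    exact (Submodule.eq_of_le_of_finrank_le hV' (by omega)).ge

end mulVars

section baseChange

variable {L : Type} [Field L] [Algebra K L] {n d : ℕ}

/-- Apply a linear functional `φ : L → K` to all coefficients of a polynomial. -/
noncomputable def mapCoeff (φ : L →ₗ[K] K) :
    MvPolynomial (Fin n) L →ₗ[K] MvPolynomial (Fin n) K :=
  (basisMonomials (Fin n) K).repr.symm.toLinearMap ∘ₗ Finsupp.mapRange.linearMap φ ∘ₗ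
    ((basisMonomials (Fin n) L).repr.restrictScalars K).toLinearMap

lemma coeff_mapCoeff (φ : L →ₗ[K] K) (f : MvPolynomial (Fin n) L) (v : Fin n →₀ ℕ) :
    coeff v (mapCoeff φ f) = φ (coeff v f) := rfl

lemma mapCoeff_X_mul (φ : L →ₗ[K] K) (t : Fin n) (f : MvPolynomial (Fin n) L) :
    mapCoeff φ (X t * f) = X t * mapCoeff φ f := by
  classical
  ext v
  rw [coeff_mapCoeff, coeff_X_mul', coeff_X_mul', apply_ite φ, map_zero, coeff_mapCoeff]

lemma mapCoeff_smul_map (φ : L →ₗ[K] K) (c : L) (f : MvPolynomial (Fin n) K) :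
    mapCoeff φ (c • map (algebraMap K L) f) = φ c • f := by
  ext v
  rw [coeff_mapCoeff, coeff_smul, coeff_smul, coeff_map, smul_eq_mul, smul_eq_mul, mul_comm c,
    ← Algebra.smul_def, map_smul, smul_eq_mul, mul_comm]

lemma mapCoeff_smul (φ : L →ₗ[K] K) (c : L) (f : MvPolynomial (Fin n) L) :
    mapCoeff φ (c • f) = mapCoeff (φ ∘ₗ LinearMap.mulLeft K c) f := by
  ext v
  simp [coeff_mapCoeff]

lemma mapCoeff_koszulMap (φ : L →ₗ[K] K) (z : Finset (Fin n) → MvPolynomial (Fin n) L) :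
    (fun s => mapCoeff φ (koszulMap X z s)) = koszulMap X fun s => mapCoeff φ (z s) := by
  ext1 s
  rw [koszulMap_apply, koszulMap_apply, Finset.sum_apply, Finset.sum_apply, map_sum]
  refine Finset.sum_congr rfl fun t _ => ?_
  simp only [Pi.smul_apply, smul_eq_mul, mapCoeff_X_mul]
  by_cases h : t ∈ s
  · simp [extContract, h]
  · rw [extContract_of_notMem h, extContract_of_notMem h, map_zsmul]

variable (L) in
/-- The extension of scalars of a space of polynomials. -/
noncomputable def baseChangeSpace (V : Submodule K (MvPolynomial (Fin n) K)) :
    Submodule L (MvPolynomial (Fin n) L) :=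
  Submodule.span L (map (algebraMap K L) '' V)

variable {V : Submodule K (MvPolynomial (Fin n) K)}

lemma map_mem_baseChangeSpace {f : MvPolynomial (Fin n) K} (hf : f ∈ V) :
    map (algebraMap K L) f ∈ baseChangeSpace L V :=
  Submodule.subset_span ⟨f, hf, rfl⟩

lemma mapCoeff_mem_of_mem_baseChangeSpace {f : MvPolynomial (Fin n) L}
    (hf : f ∈ baseChangeSpace L V) (φ : L →ₗ[K] K) : mapCoeff φ f ∈ V := by
  induction hf using Submodule.span_induction generalizing φ with
  | mem f hf =>
    obtain ⟨g, hg, rfl⟩ := hf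
    rw [← one_smul L (map _ g), mapCoeff_smul_map]
    exact V.smul_mem _ hg
  | zero => rw [map_zero]; exact V.zero_mem
  | add f g _ _ hf hg => rw [map_add]; exact V.add_mem (hf φ) (hg φ)
  | smul c f _ hf => rw [mapCoeff_smul]; exact hf _

lemma baseChangeSpace_le (hV : V ≤ homogeneousSubmodule (Fin n) K d) :
    baseChangeSpace L V ≤ homogeneousSubmodule (Fin n) L d := by
  refine Submodule.span_le.2 ?_
  rintro _ ⟨f, hf, rfl⟩
  exact IsHomogeneous.map (hV hf) _

lemma mulVars_baseChangeSpace :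
    mulVars (baseChangeSpace L V) = baseChangeSpace L (mulVars V) := by
  refine le_antisymm (mulVars_le fun t f hf => ?_) (Submodule.span_le.2 ?_)
  · induction hf using Submodule.span_induction with
    | mem f hf =>
      obtain ⟨g, hg, rfl⟩ := hf
      rw [← map_X (algebraMap K L), ← map_mul]
      exact map_mem_baseChangeSpace (X_mul_mem_mulVars t hg)
    | zero => rw [mul_zero]; exact Submodule.zero_mem _
    | add f g _ _ hf hg => rw [mul_add]; exact Submodule.add_mem _ hf hg
    | smul c f _ hf => rw [mul_smul_comm]; exact Submodule.smul_mem _ _ hf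
  · rintro _ ⟨g, hg, rfl⟩
    have : mulVars V ≤ ((mulVars (baseChangeSpace L V)).restrictScalars K).comap
        (mapAlgHom (σ := Fin n) (Algebra.ofId K L)).toLinearMap := by
      refine mulVars_le fun t f hf => ?_
      change map (algebraMap K L) (X t * f) ∈ mulVars (baseChangeSpace L V)
      rw [map_mul, map_X]
      exact X_mul_mem_mulVars t (map_mem_baseChangeSpace hf)
    exact this hg

lemma finrank_baseChangeSpace [FiniteDimensional K V] :
    Module.finrank L (baseChangeSpace L V) = Module.finrank K V := by
  let b := Module.finBasis K V
  have hspan : baseChangeSpace L V =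
      Submodule.span L (Set.range fun i => map (algebraMap K L) (b i : MvPolynomial (Fin n) K)) := by
    refine le_antisymm (Submodule.span_le.2 ?_) (Submodule.span_le.2 ?_)
    · rintro _ ⟨f, hf, rfl⟩
      have h := congrArg (fun g : V => map (algebraMap K L) (g : MvPolynomial (Fin n) K))
        (b.sum_repr ⟨f, hf⟩)
      simp only [AddSubmonoidClass.coe_finsetSum, Submodule.coe_smul, map_sum] at h
      rw [← h]
      refine Submodule.sum_mem _ fun i _ => ?_
      rw [smul_eq_C_mul, map_mul, map_C, ← smul_eq_C_mul]
      exact Submodule.smul_mem _ _ (Submodule.subset_span ⟨i, rfl⟩)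
    · rintro _ ⟨i, rfl⟩
      exact map_mem_baseChangeSpace (b i).2
  have hli : LinearIndependent L
      fun i => map (algebraMap K L) (b i : MvPolynomial (Fin n) K) := by
    rw [Fintype.linearIndependent_iff]
    intro c hc i
    rw [← Module.forall_dual_apply_eq_zero_iff K]
    intro φ
    have h := congrArg (mapCoeff φ) hc
    simp only [map_sum, mapCoeff_smul_map, map_zero] at h
    have hb : LinearIndependent K fun i => (b i : MvPolynomial (Fin n) K) :=
      b.linearIndependent.map' V.subtype V.ker_subtype
    exact Fintype.linearIndependent_iff.1 hb _ h i
  rw [hspan, finrank_span_eq_card hli, Fintype.card_fin]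

lemma KoszulExact.of_baseChangeSpace {U : Submodule K (MvPolynomial (Fin n) K)}
    (h : KoszulExact X (baseChangeSpace L V) (baseChangeSpace L U)) : KoszulExact X V U := by
  intro z hz hz0
  obtain ⟨φ, hφ⟩ := LinearMap.exists_leftInverse_of_injective (Algebra.linearMap K L)
    (LinearMap.ker_eq_bot.2 (algebraMap K L).injective)
  have hφ1 : φ 1 = 1 := by simpa using LinearMap.congr_fun hφ 1
  have hmap : koszulMap X (fun s => map (algebraMap K L) (z s)) = 0 := by
    have h1 := map_koszulMap (map (σ := Fin n) (algebraMap K L)) X z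
    simp only [map_X] at h1
    change koszulMap (fun t => X t) _ = 0
    rw [← h1, hz0]
    ext1 s
    exact map_zero _
  obtain ⟨w, hw, hwz⟩ := h _ (fun s => map_mem_baseChangeSpace (hz s)) hmap
  refine ⟨fun s => mapCoeff φ (w s), fun s => mapCoeff_mem_of_mem_baseChangeSpace (hw s) φ, ?_⟩
  rw [← mapCoeff_koszulMap, hwz]
  ext1 s
  beta_reduce
  rw [← one_smul L (map _ (z s)), mapCoeff_smul_map, hφ1, one_smul]

end baseChange

/-- Macaulay's bound on the growth of a space of forms, and the exactness of the Koszul complex in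
case of minimal growth. -/
theorem lexGrowth_le_and_koszulExact (n d : ℕ)
    (V : Submodule K (MvPolynomial (Fin n) K)) (hV : V ≤ homogeneousSubmodule (Fin n) K d) :
    lexGrowth n d (Module.finrank K V) ≤ Module.finrank K (mulVars V) ∧
      (Module.finrank K (mulVars V) ≤ lexGrowth n d (Module.finrank K V) →
        KoszulExact X V (mulVars V)) := by
  have := finiteDimensional_of_le hV
  have := finiteDimensional_of_le (mulVars_le_homogeneousSubmodule hV)
  have h := lexGrowth_le_and_koszulExact_of_infinite n d
    (baseChangeSpace (AlgebraicClosure K) V) (baseChangeSpace_le hV)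
  rw [mulVars_baseChangeSpace, finrank_baseChangeSpace, finrank_baseChangeSpace] at h
  exact ⟨h.1, fun hle => (h.2 hle).of_baseChangeSpace⟩

section gradedBetti

variable {n : ℕ} {I : Ideal (MvPolynomial (Fin n) K)} {d : ℕ}

lemma mem_idealPiece_natCast {f : MvPolynomial (Fin n) K} :
    f ∈ idealPiece I (d : ℤ) ↔ f ∈ I ∧ f.IsHomogeneous d := by
  rw [idealPiece, if_pos (Int.natCast_nonneg d), Int.toNat_natCast]
  rfl

lemma idealPiece_natCast_le : idealPiece I (d : ℤ) ≤ homogeneousSubmodule (Fin n) K d :=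
  fun _ hf => (mem_idealPiece_natCast.1 hf).2

lemma idealPiece_of_neg {k : ℤ} (hk : k < 0) : idealPiece I k = ⊥ :=
  if_neg (not_le.2 hk)

instance (k : ℤ) : FiniteDimensional K (idealPiece I k) := by
  by_cases hk : 0 ≤ k
  · lift k to ℕ using hk
    exact finiteDimensional_of_le idealPiece_natCast_le
  · rw [idealPiece_of_neg (not_le.1 hk)]
    infer_instance

lemma mulVars_idealPiece_le {k : ℤ} : mulVars (idealPiece I k) ≤ idealPiece I (k + 1) :=
  mulVars_le fun t _ hf => mul_X_mem_idealPiece I t k hf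

/-- Extension by zero of a family indexed by the sets of size `i` to all sets. -/
noncomputable def extendIdx {i : ℕ} {k : ℤ} (z : KoszulIdx n i → idealPiece I k)
    (s : Finset (Fin n)) : MvPolynomial (Fin n) K :=
  if h : s.card = i then z ⟨s, h⟩ else 0

lemma extendIdx_mem {i : ℕ} {k : ℤ} (z : KoszulIdx n i → idealPiece I k) (s : Finset (Fin n)) :
    extendIdx z s ∈ idealPiece I k := by
  unfold extendIdx
  split_ifs with h
  · exact (z _).2
  · exact Submodule.zero_mem _

lemma extendIdx_coe {i : ℕ} {k : ℤ} (z : KoszulIdx n i → idealPiece I k) (s : KoszulIdx n i) :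
    extendIdx z s = z s := dif_pos s.2

lemma coe_koszulDiff_apply (i : ℕ) (j : ℤ) (z : KoszulIdx n (i + 1) → idealPiece I (j - (i + 1 : ℕ)))
    (s : KoszulIdx n i) :
    ((koszulDiff I i j z s : idealPiece I (j - i)) : MvPolynomial (Fin n) K) =
      koszulMap X (extendIdx z) s := by
  classical
  rw [koszulMap_apply, Finset.sum_apply]
  have hterm : ∀ (s' : KoszulIdx n (i + 1)) (t : {t // t ∈ (s' : Finset (Fin n))}),
      ((((-1 : K) ^ (((s' : Finset (Fin n)).filter (fun u => u < t.1)).card)) •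
      ((LinearMap.single (R := K) (φ := fun _ : KoszulIdx n i => idealPiece I (j - (i : ℕ)))
          ⟨(s' : Finset (Fin n)).erase t.1, by
            rw [Finset.card_erase_of_mem t.2, s'.2]; rfl⟩) ∘ₗ
        (LinearEquiv.ofEq _ _ (by rw [show j - ((i : ℕ) + 1 : ℕ) + 1 = j - (i : ℕ) by push_cast; ring])).toLinearMap ∘ₗ
        (mulXPiece I t.1 (j - ((i : ℕ) + 1 : ℕ))) ∘ₗ
        (LinearMap.proj s'))) z s : MvPolynomial (Fin n) K) =
      if (s' : Finset (Fin n)).erase t.1 = s then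
        (-1 : K) ^ (((s' : Finset (Fin n)).filter (fun u => u < t.1)).card) •
          (X t.1 * (z s' : MvPolynomial (Fin n) K)) else 0 := by
    intro s' t
    simp only [LinearMap.smul_apply, LinearMap.comp_apply, Pi.smul_apply, Submodule.coe_smul,
      LinearMap.single_apply, Pi.single_apply]
    by_cases h : (s' : Finset (Fin n)).erase t.1 = s
    · rw [if_pos h, if_pos (Subtype.ext h.symm)]
      rfl
    · rw [if_neg h, if_neg fun h' => h (congrArg Subtype.val h').symm]
      simp
  rw [koszulDiff]
  simp only [LinearMap.sum_apply, Finset.sum_apply, AddSubmonoidClass.coe_finsetSum, hterm]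
  have hattach : ∀ s' : KoszulIdx n (i + 1),
      (∑ t ∈ (s' : Finset (Fin n)).attach, if (s' : Finset (Fin n)).erase t.1 = s then
        (-1 : K) ^ (((s' : Finset (Fin n)).filter (fun u => u < t.1)).card) •
          (X t.1 * (z s' : MvPolynomial (Fin n) K)) else 0) =
      ∑ t, if t ∉ (s : Finset (Fin n)) ∧ (s' : Finset (Fin n)) = insert t (s : Finset (Fin n)) then
        insertSign t s • (X t * extendIdx z s') else 0 := by
    intro s'
    rw [Finset.sum_attach (s' : Finset (Fin n)) fun t =>
      if (s' : Finset (Fin n)).erase t = s then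
        (-1 : K) ^ (((s' : Finset (Fin n)).filter (fun u => u < t)).card) •
          (X t * (z s' : MvPolynomial (Fin n) K)) else 0]
    refine Finset.sum_subset_zero_on_sdiff (Finset.subset_univ _) ?_ fun t ht => ?_
    · intro t ht
      refine if_neg fun h => (Finset.mem_sdiff.1 ht).2 ?_
      rw [h.2]
      exact Finset.mem_insert_self _ _
    · by_cases h : (s' : Finset (Fin n)).erase t = s
      · have h1 : t ∉ (s : Finset (Fin n)) := h ▸ Finset.notMem_erase t _
        have h2 : (s' : Finset (Fin n)) = insert t (s : Finset (Fin n)) := by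
          rw [← h, Finset.insert_erase ht]
        rw [if_pos h, if_pos ⟨h1, h2⟩, extendIdx_coe, h2, Finset.filter_insert, if_neg (lt_irrefl t),
          insertSign, ← Int.cast_smul_eq_zsmul K]
        push_cast
        rfl
      · rw [if_neg h, if_neg]
        rintro ⟨h1, h2⟩
        exact h (by rw [h2, Finset.erase_insert h1])
  rw [Finset.sum_congr rfl fun s' _ => hattach s', Finset.sum_comm]
  refine Finset.sum_congr rfl fun t _ => ?_
  by_cases ht : t ∈ (s : Finset (Fin n))
  · rw [Pi.smul_apply, extContract_of_mem ht]
    simp [ht]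
  · have hc : (insert t (s : Finset (Fin n))).card = i + 1 := by
      rw [Finset.card_insert_of_notMem ht, s.2]
    rw [Pi.smul_apply, extContract_of_notMem ht,
      Finset.sum_eq_single_of_mem ⟨_, hc⟩ (Finset.mem_univ _)]
    · rw [if_pos ⟨ht, rfl⟩, smul_eq_mul, mul_smul_comm]
    · intro s' _ hs'
      exact if_neg fun h => hs' (Subtype.ext h.2)

lemma gradedBetti_eq_zero_of_koszulExact
    (h : KoszulExact X (idealPiece I (d : ℤ)) (idealPiece I ((d : ℤ) + 1))) (i : ℕ) (j : ℤ)
    (hj : j - i = d + 1) : gradedBetti I i j = 0 := by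
  have hle : koszulCycles I i j ≤ LinearMap.range (koszulDiff I i j) := by
    intro z hz
    have hz0 : koszulMap X (extendIdx z) = 0 := by
      ext1 s
      cases i with
      | zero =>
        rw [koszulMap_apply, Finset.sum_apply]
        refine Finset.sum_eq_zero fun t _ => ?_
        rw [Pi.smul_apply]
        by_cases ht : t ∈ s
        · rw [extContract_of_mem ht, smul_zero]
        · have : extendIdx z (insert t s) = 0 :=
            dif_neg (Finset.card_ne_zero_of_mem (Finset.mem_insert_self t s))
          rw [extContract_of_notMem ht, this, smul_zero, smul_zero]
      | succ i =>
        by_cases hs : s.card = i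
        · rw [← coe_koszulDiff_apply i j z ⟨s, hs⟩, (LinearMap.mem_ker.1 hz : _ = _)]
          rfl
        · rw [koszulMap_apply, Finset.sum_apply]
          refine Finset.sum_eq_zero fun t _ => ?_
          rw [Pi.smul_apply]
          by_cases ht : t ∈ s
          · rw [extContract_of_mem ht, smul_zero]
          · have : extendIdx z (insert t s) = 0 :=
              dif_neg (by rw [Finset.card_insert_of_notMem ht]; omega)
            rw [extContract_of_notMem ht, this, smul_zero, smul_zero]
    obtain ⟨w, hw, hwz⟩ := h (extendIdx z) (fun s => hj ▸ extendIdx_mem z s) hz0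
    have hj' : j - (i + 1 : ℕ) = d := by push_cast; omega
    refine ⟨fun s => ⟨w s, hj' ▸ hw s⟩, funext fun s => Subtype.ext ?_⟩
    rw [coe_koszulDiff_apply]
    rw [← extendIdx_coe z s, ← hwz, koszulMap_apply, koszulMap_apply, Finset.sum_apply, Finset.sum_apply]
    refine Finset.sum_congr rfl fun t _ => ?_
    rw [Pi.smul_apply, Pi.smul_apply]
    by_cases ht : t ∈ (s : Finset (Fin n))
    · rw [extContract_of_mem ht, extContract_of_mem ht]
    · rw [extContract_of_notMem ht, extContract_of_notMem ht]
      congr 2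
      exact dif_pos (by rw [Finset.card_insert_of_notMem ht, s.2])
  rw [gradedBetti, inf_eq_right.2 hle, Nat.sub_self]

/-- The ideal `I` grows minimally from degree `d` to degree `d + 1`. -/
def MinimalGrowth (I : Ideal (MvPolynomial (Fin n) K)) (d : ℕ) : Prop :=
  Module.finrank K (idealPiece I ((d : ℤ) + 1)) ≤
    lexGrowth n d (Module.finrank K (idealPiece I (d : ℤ)))

lemma lexGrowth_finrank_idealPiece_le (I : Ideal (MvPolynomial (Fin n) K)) (d : ℕ) :
    lexGrowth n d (Module.finrank K (idealPiece I (d : ℤ))) ≤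
      Module.finrank K (idealPiece I ((d : ℤ) + 1)) :=
  (lexGrowth_le_and_koszulExact n d _ idealPiece_natCast_le).1.trans
    (Submodule.finrank_mono mulVars_idealPiece_le)

lemma MinimalGrowth.gradedBetti_eq_zero (h : MinimalGrowth I d) (i : ℕ) (j : ℤ)
    (hj : j - i = d + 1) : gradedBetti I i j = 0 := by
  have h1 := lexGrowth_le_and_koszulExact n d _ (idealPiece_natCast_le (I := I))
  have h2 : mulVars (idealPiece I (d : ℤ)) = idealPiece I ((d : ℤ) + 1) :=
    Submodule.eq_of_le_of_finrank_le mulVars_idealPiece_le (le_trans h h1.1)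
  rw [h2] at h1
  exact gradedBetti_eq_zero_of_koszulExact (h1.2 h) i j hj

end gradedBetti

section monomialSpace

variable {n d : ℕ} {E : Finset (Fin n →₀ ℕ)}

lemma finrank_restrictSupport (E : Finset (Fin n →₀ ℕ)) :
    Module.finrank K (restrictSupport K (E : Set (Fin n →₀ ℕ))) = E.card := by
  rw [Module.finrank_eq_card_basis (basisRestrictSupport K (E : Set (Fin n →₀ ℕ)))]
  exact Fintype.card_coe E

lemma restrictSupport_le_homogeneousSubmodule (hE : E ⊆ exponents n d) :
    restrictSupport K (E : Set (Fin n →₀ ℕ)) ≤ homogeneousSubmodule (Fin n) K d := by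
  rw [restrictSupport_eq_span, Submodule.span_le]
  rintro _ ⟨v, hv, rfl⟩
  refine isHomogeneous_monomial _ ?_
  rw [Finsupp.degree_eq_sum]
  exact mem_exponents.1 (hE hv)

lemma mulVars_restrictSupport (E : Finset (Fin n →₀ ℕ)) :
    mulVars (restrictSupport K (E : Set (Fin n →₀ ℕ))) =
      restrictSupport K (upperShadow E : Set (Fin n →₀ ℕ)) := by
  refine le_antisymm (mulVars_le fun t f hf => ?_) ?_
  · rw [restrictSupport_eq_span] at hf
    induction hf using Submodule.span_induction with
    | mem f hf =>
      obtain ⟨v, hv, rfl⟩ := hf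
      rw [mul_comm, X, monomial_mul, one_mul, monomial_mem_restrictSupport]
      exact Or.inl (mem_upperShadow.2 ⟨v, hv, t, rfl⟩)
    | zero => rw [mul_zero]; exact Submodule.zero_mem _
    | add f g _ _ hf hg => rw [mul_add]; exact Submodule.add_mem _ hf hg
    | smul c f _ hf => rw [mul_smul_comm]; exact Submodule.smul_mem _ _ hf
  · rw [restrictSupport_eq_span K (upperShadow E : Set (Fin n →₀ ℕ)), Submodule.span_le]
    rintro _ ⟨w, hw, rfl⟩
    obtain ⟨v, hv, t, rfl⟩ := mem_upperShadow.1 hw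
    have : (monomial (v + Finsupp.single t 1) (1 : K)) = X t * monomial v 1 := by
      rw [mul_comm, X, monomial_mul, one_mul]
    beta_reduce
    rw [this]
    exact X_mul_mem_mulVars t ((monomial_mem_restrictSupport K).2 (Or.inl hv))

/-- Macaulay's theorem for sets of monomials: lex segments have the smallest upper shadows. -/
lemma lexGrowth_card_le_card_upperShadow (hE : E ⊆ exponents n d) :
    lexGrowth n d E.card ≤ (upperShadow E).card := by
  have h := (lexGrowth_le_and_koszulExact n d (restrictSupport ℚ (E : Set (Fin n →₀ ℕ)))
    (restrictSupport_le_homogeneousSubmodule hE)).1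
  rwa [mulVars_restrictSupport, finrank_restrictSupport, finrank_restrictSupport] at h

lemma finrank_le_card_exponents {V : Submodule K (MvPolynomial (Fin n) K)}
    (hV : V ≤ homogeneousSubmodule (Fin n) K d) :
    Module.finrank K V ≤ (exponents n d).card := by
  have h : homogeneousSubmodule (Fin n) K d ≤
      restrictSupport K (exponents n d : Set (Fin n →₀ ℕ)) := by
    intro f hf
    rw [mem_restrictSupport_iff]
    intro v hv
    have := hf (mem_support_iff.1 hv)
    rwa [Finset.mem_coe, mem_exponents, ← Finsupp.degree_eq_sum, Finsupp.degree_eq_weight_one]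
  rw [← finrank_restrictSupport (K := K)]
  have := Module.Finite.of_basis
    (basisRestrictSupport K (exponents n d : Set (Fin n →₀ ℕ)))
  exact Submodule.finrank_mono (hV.trans h)

/-- The growth of a union of lex segments lying in the slices given by the first exponent. -/
lemma lexGrowth_sum_le {a b : ℕ → ℕ} (ha : ∀ k ≤ d, a k ≤ (exponents n (d - k)).card)
    (hb : ∀ k < d, lexGrowth n (d - (k + 1)) (a (k + 1)) ≤ b (k + 1))
    (hb' : ∀ k ≤ d, a k ≤ b (k + 1)) :
    lexGrowth (n + 1) d (∑ k ∈ Finset.range (d + 1), a k) ≤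
      lexGrowth n d (a 0) + ∑ k ∈ Finset.range (d + 1), b (k + 1) := by
  classical
  set L : ℕ → Finset (Fin n →₀ ℕ) := fun k => lexSegment n (d - k) (a k) with hL
  have hLseg : ∀ k, IsLexSegment (d - k) (L k) := fun k => isLexSegment_lexSegment _ _ _
  set T := (Finset.range (d + 1)).biUnion fun k => (L k).image (Finsupp.cons k) with hT
  have hinj : ∀ k : ℕ, Function.Injective (Finsupp.cons (n := n) k) := fun k v w h => by
    rw [← Finsupp.tail_cons k v, h, Finsupp.tail_cons]
  have hTcard : T.card = ∑ k ∈ Finset.range (d + 1), a k := by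
    rw [hT, Finset.card_biUnion]
    · refine Finset.sum_congr rfl fun k hk => ?_
      rw [Finset.card_image_of_injective _ (hinj k),
        card_lexSegment (ha k (by rw [Finset.mem_range] at hk; omega))]
    · intro k _ l _ hkl
      refine Finset.disjoint_left.2 fun v hv hv' => hkl ?_
      obtain ⟨u, _, rfl⟩ := Finset.mem_image.1 hv
      obtain ⟨w, _, h⟩ := Finset.mem_image.1 hv'
      simpa using (DFunLike.congr_fun h 0).symm
  have hTsub : T ⊆ exponents (n + 1) d := by
    intro v hv
    obtain ⟨k, hk, hv⟩ := Finset.mem_biUnion.1 hv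
    obtain ⟨u, hu, rfl⟩ := Finset.mem_image.1 hv
    have := mem_exponents.1 ((hLseg k).1 hu)
    rw [Finset.mem_range] at hk
    rw [mem_exponents, sum_cons, this]
    omega
  set S : ℕ → Finset (Fin n →₀ ℕ) := fun k =>
    (if k < d then upperShadow (L (k + 1)) else ∅) ∪ L k with hS
  have hScard : ∀ k ∈ Finset.range (d + 1), (S k).card ≤ b (k + 1) := by
    intro k hk
    rw [Finset.mem_range] at hk
    have hLk := (card_lexSegment_le n (d - k) (a k)).trans (hb' k (by omega))
    by_cases hkd : k < d
    · rw [hS]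
      simp only [if_pos hkd]
      have h1 := (hLseg (k + 1)).upperShadow
      rw [show d - (k + 1) + 1 = d - k by omega] at h1
      exact (h1.card_union_le_max (hLseg k)).trans (max_le (hb k hkd) hLk)
    · rw [hS]
      simp only [if_neg hkd, Finset.empty_union]
      exact hLk
  have hsub : upperShadow T ⊆ (upperShadow (L 0)).image (Finsupp.cons 0) ∪
      (Finset.range (d + 1)).biUnion fun k => (S k).image (Finsupp.cons (k + 1)) := by
    intro w hw
    obtain ⟨v, hv, t, rfl⟩ := mem_upperShadow.1 hw
    obtain ⟨k, hk, hv⟩ := Finset.mem_biUnion.1 hv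
    obtain ⟨u, hu, rfl⟩ := Finset.mem_image.1 hv
    rw [Finset.mem_union]
    refine Fin.cases ?_ (fun t => ?_) t
    · refine Or.inr (Finset.mem_biUnion.2 ⟨k, hk, Finset.mem_image.2
        ⟨u, Finset.mem_union_right _ hu, ?_⟩⟩)
      ext i
      refine Fin.cases ?_ (fun i => ?_) i
      · simp
      · simp
    · have h1 : Finsupp.cons k (u + Finsupp.single t 1) =
          Finsupp.cons k u + Finsupp.single t.succ 1 := by
        ext i
        refine Fin.cases ?_ (fun i => ?_) i
        · simp
        · simp [Finsupp.single_apply]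
      have h2 : u + Finsupp.single t 1 ∈ upperShadow (L k) := mem_upperShadow.2 ⟨u, hu, t, rfl⟩
      cases k with
      | zero => exact Or.inl (Finset.mem_image.2 ⟨_, h2, h1⟩)
      | succ k =>
        rw [Finset.mem_range] at hk
        refine Or.inr (Finset.mem_biUnion.2 ⟨k, Finset.mem_range.2 (by omega),
          Finset.mem_image.2 ⟨_, Finset.mem_union_left _ ?_, h1⟩⟩)
        rwa [if_pos (by omega)]
  calc lexGrowth (n + 1) d (∑ k ∈ Finset.range (d + 1), a k)
      ≤ (upperShadow T).card := hTcard ▸ lexGrowth_card_le_card_upperShadow hTsub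
    _ ≤ _ := Finset.card_le_card hsub
    _ ≤ _ := Finset.card_union_le _ _
    _ ≤ (upperShadow (L 0)).card + ∑ k ∈ Finset.range (d + 1), (S k).card :=
      add_le_add Finset.card_image_le (Finset.card_biUnion_le.trans
        (Finset.sum_le_sum fun k _ => Finset.card_image_le))
    _ ≤ _ := add_le_add le_rfl (Finset.sum_le_sum hScard)

end monomialSpace

section contraction

variable {n d : ℕ} {V : Submodule K (MvPolynomial (Fin (n + 1)) K)}

lemma finSuccEquiv_rename_succ (f : MvPolynomial (Fin n) K) :
    finSuccEquiv K n (rename Fin.succ f) = Polynomial.C f := by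
  induction f using MvPolynomial.induction_on with
  | C a => simp [finSuccEquiv_apply]
  | add f g hf hg => rw [map_add, map_add, hf, hg, map_add]
  | mul_X f i hf => rw [map_mul, map_mul, hf, rename_X, finSuccEquiv_X_succ, map_mul]

/-- The coefficient of the `k`-th power of the first variable. -/
noncomputable def firstVarCoeff (k : ℕ) :
    MvPolynomial (Fin (n + 1)) K →ₗ[K] MvPolynomial (Fin n) K :=
  ((Polynomial.lcoeff (MvPolynomial (Fin n) K) k).restrictScalars K) ∘ₗ
    (finSuccEquiv K n).toLinearMap

lemma firstVarCoeff_apply (k : ℕ) (f : MvPolynomial (Fin (n + 1)) K) :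
    firstVarCoeff k f = (finSuccEquiv K n f).coeff k := rfl

lemma firstVarCoeff_succ_X_zero_mul (k : ℕ) (f : MvPolynomial (Fin (n + 1)) K) :
    firstVarCoeff (k + 1) (X 0 * f) = firstVarCoeff k f := by
  rw [firstVarCoeff_apply, map_mul, finSuccEquiv_X_zero, Polynomial.coeff_X_mul,
    firstVarCoeff_apply]

lemma firstVarCoeff_X_succ_mul (k : ℕ) (t : Fin n) (f : MvPolynomial (Fin (n + 1)) K) :
    firstVarCoeff k (X t.succ * f) = X t * firstVarCoeff k f := by
  rw [firstVarCoeff_apply, map_mul, finSuccEquiv_X_succ, Polynomial.coeff_C_mul,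
    firstVarCoeff_apply]

lemma ext_firstVarCoeff {f g : MvPolynomial (Fin (n + 1)) K}
    (h : ∀ k, firstVarCoeff k f = firstVarCoeff k g) : f = g :=
  (finSuccEquiv K n).injective (Polynomial.ext h)

lemma firstVarCoeff_rename_succ (k : ℕ) (f : MvPolynomial (Fin n) K) :
    firstVarCoeff k (rename Fin.succ f) = if k = 0 then f else 0 := by
  rw [firstVarCoeff_apply, finSuccEquiv_rename_succ, Polynomial.coeff_C]

/-- The elements of `V` of degree less than `k` in the first variable. -/
noncomputable def firstVarFiltration (V : Submodule K (MvPolynomial (Fin (n + 1)) K)) (k : ℕ) :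
    Submodule K (MvPolynomial (Fin (n + 1)) K) :=
  V ⊓ ⨅ l : ℕ, ⨅ _ : k ≤ l, LinearMap.ker (firstVarCoeff l)

lemma mem_firstVarFiltration {k : ℕ} {f : MvPolynomial (Fin (n + 1)) K} :
    f ∈ firstVarFiltration V k ↔ f ∈ V ∧ ∀ l, k ≤ l → firstVarCoeff l f = 0 := by
  simp [firstVarFiltration, Submodule.mem_iInf]

/-- The leading coefficients of the elements of `V` of degree `k` in the first variable. -/
noncomputable def firstVarLayer (V : Submodule K (MvPolynomial (Fin (n + 1)) K)) (k : ℕ) :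
    Submodule K (MvPolynomial (Fin n) K) :=
  (firstVarFiltration V (k + 1)).map (firstVarCoeff k)

lemma mem_firstVarLayer {k : ℕ} {g : MvPolynomial (Fin n) K} :
    g ∈ firstVarLayer V k ↔
      ∃ f ∈ V, (∀ l, k + 1 ≤ l → firstVarCoeff l f = 0) ∧ firstVarCoeff k f = g := by
  simp only [firstVarLayer, Submodule.mem_map, mem_firstVarFiltration, and_assoc]

lemma firstVarLayer_le (hV : V ≤ homogeneousSubmodule (Fin (n + 1)) K d) {k : ℕ} (hk : k ≤ d) :
    firstVarLayer V k ≤ homogeneousSubmodule (Fin n) K (d - k) := by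
  intro g hg
  obtain ⟨f, hf, -, rfl⟩ := mem_firstVarLayer.1 hg
  exact (hV hf).finSuccEquiv_coeff_isHomogeneous k (d - k) (by omega)

lemma finrank_firstVarFiltration [FiniteDimensional K V] (k : ℕ) :
    Module.finrank K (firstVarFiltration V k) =
      ∑ l ∈ Finset.range k, Module.finrank K (firstVarLayer V l) := by
  induction k with
  | zero =>
    have : firstVarFiltration V 0 = ⊥ := by
      rw [eq_bot_iff]
      intro f hf
      refine (Submodule.mem_bot K).2 (ext_firstVarCoeff fun k => ?_)
      rw [(mem_firstVarFiltration.1 hf).2 k (Nat.zero_le k), map_zero]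
    rw [this, finrank_bot, Finset.sum_range_zero]
  | succ k ih =>
    rw [Finset.sum_range_succ, ← ih]
    have hle : firstVarFiltration V k ≤ firstVarFiltration V (k + 1) := fun f hf => by
      rw [mem_firstVarFiltration] at hf ⊢
      exact ⟨hf.1, fun l hl => hf.2 l (by omega)⟩
    have : FiniteDimensional K (firstVarFiltration V (k + 1)) :=
      Submodule.finiteDimensional_of_le (inf_le_left : firstVarFiltration V (k + 1) ≤ V)
    set g := (firstVarCoeff k).domRestrict (firstVarFiltration V (k + 1)) with hg
    have h1 := g.finrank_range_add_finrank_ker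
    have h2 : LinearMap.range g = firstVarLayer V k := LinearMap.range_domRestrict _ _
    have h3 : (LinearMap.ker g).map (Submodule.subtype _) = firstVarFiltration V k := by
      ext f
      simp only [Submodule.mem_map, LinearMap.mem_ker, hg, LinearMap.domRestrict_apply,
        Submodule.subtype_apply, Subtype.exists, exists_and_right, exists_eq_right]
      constructor
      · rintro ⟨hf, hf'⟩
        rw [mem_firstVarFiltration] at hf ⊢
        refine ⟨hf.1, fun l hl => ?_⟩
        rcases hl.eq_or_lt with rfl | hl
        · exact hf'
        · exact hf.2 l hl
      · exact fun hf => ⟨hle hf, (mem_firstVarFiltration.1 hf).2 k le_rfl⟩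
    rw [← h1, h2, ← h3,
      ← (Submodule.equivMapOfInjective _ (Submodule.injective_subtype _) _).finrank_eq, add_comm]

lemma finrank_eq_sum_firstVarLayer (hV : V ≤ homogeneousSubmodule (Fin (n + 1)) K d) :
    Module.finrank K V = ∑ k ∈ Finset.range (d + 1), Module.finrank K (firstVarLayer V k) := by
  have := finiteDimensional_of_le hV
  have hfil : firstVarFiltration V (d + 1) = V := by
    refine le_antisymm inf_le_left fun f hf => mem_firstVarFiltration.2 ⟨hf, fun l hl => ?_⟩
    rw [firstVarCoeff_apply]
    refine Polynomial.coeff_eq_zero_of_natDegree_lt (lt_of_le_of_lt ?_ hl)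
    rw [natDegree_finSuccEquiv]
    exact (degreeOf_le_totalDegree f 0).trans (IsHomogeneous.totalDegree_le (hV hf))
  rw [← finrank_firstVarFiltration, hfil]

/-- Minimal growth passes to the elimination of the first variable. -/
lemma finrank_firstVarLayer_le_lexGrowth {U : Submodule K (MvPolynomial (Fin (n + 1)) K)}
    (hV : V ≤ homogeneousSubmodule (Fin (n + 1)) K d)
    (hU : U ≤ homogeneousSubmodule (Fin (n + 1)) K (d + 1)) (hVU : mulVars V ≤ U)
    (h : Module.finrank K U ≤ lexGrowth (n + 1) d (Module.finrank K V)) :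
    Module.finrank K (firstVarLayer U 0) ≤
      lexGrowth n d (Module.finrank K (firstVarLayer V 0)) := by
  have hfin : ∀ k ≤ d + 1, FiniteDimensional K (firstVarLayer U k) := fun k hk =>
    finiteDimensional_of_le (firstVarLayer_le hU hk)
  have hsum := lexGrowth_sum_le (n := n) (d := d)
    (a := fun k => Module.finrank K (firstVarLayer V k))
    (b := fun k => Module.finrank K (firstVarLayer U k))
    (fun k hk => finrank_le_card_exponents (firstVarLayer_le hV hk))
    (fun k hk => by
      have := hfin (k + 1) (by omega)
      refine (lexGrowth_le_and_koszulExact n _ _ (firstVarLayer_le hV hk)).1.trans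
        (Submodule.finrank_mono (mulVars_le fun t g hg => ?_))
      obtain ⟨f, hf, hf', rfl⟩ := mem_firstVarLayer.1 hg
      refine mem_firstVarLayer.2 ⟨X t.succ * f, hVU (X_mul_mem_mulVars _ hf), fun l hl => ?_,
        firstVarCoeff_X_succ_mul _ _ _⟩
      rw [firstVarCoeff_X_succ_mul, hf' l hl, mul_zero])
    (fun k hk => by
      have := hfin (k + 1) (by omega)
      refine Submodule.finrank_mono fun g hg => ?_
      obtain ⟨f, hf, hf', rfl⟩ := mem_firstVarLayer.1 hg
      refine mem_firstVarLayer.2 ⟨X 0 * f, hVU (X_mul_mem_mulVars _ hf), fun l hl => ?_,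
        firstVarCoeff_succ_X_zero_mul _ _⟩
      obtain ⟨l, rfl⟩ := Nat.exists_eq_succ_of_ne_zero (show l ≠ 0 by omega)
      rw [Nat.succ_eq_add_one, firstVarCoeff_succ_X_zero_mul, hf' l (by omega)])
  rw [← finrank_eq_sum_firstVarLayer hV] at hsum
  rw [finrank_eq_sum_firstVarLayer hU, Finset.sum_range_succ'] at h
  omega

lemma firstVarLayer_zero_idealPiece (J : Ideal (MvPolynomial (Fin (n + 1)) K)) (d : ℕ) :
    firstVarLayer (idealPiece J (d : ℤ)) 0 =
      idealPiece (Ideal.comap (rename Fin.succ :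
        MvPolynomial (Fin n) K →ₐ[K] MvPolynomial (Fin (n + 1)) K) J) (d : ℤ) := by
  ext g
  rw [mem_firstVarLayer, mem_idealPiece_natCast, Ideal.mem_comap]
  constructor
  · rintro ⟨f, hf, hf', rfl⟩
    have hfe : rename Fin.succ (firstVarCoeff 0 f) = f := by
      refine ext_firstVarCoeff fun k => ?_
      rw [firstVarCoeff_rename_succ]
      split_ifs with h
      · rw [h]
      · rw [hf' k (by omega)]
    rw [mem_idealPiece_natCast] at hf
    refine ⟨by rw [hfe]; exact hf.1, ?_⟩
    rw [← IsHomogeneous.rename_isHomogeneous_iff (Fin.succ_injective n), hfe]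
    exact hf.2
  · rintro ⟨hg, hg'⟩
    refine ⟨rename Fin.succ g, mem_idealPiece_natCast.2 ⟨hg, hg'.rename_isHomogeneous⟩,
      fun l hl => ?_, ?_⟩
    · rw [firstVarCoeff_rename_succ, if_neg (by omega)]
    · rw [firstVarCoeff_rename_succ, if_pos rfl]

lemma MinimalGrowth.comap_rename_succ {J : Ideal (MvPolynomial (Fin (n + 1)) K)}
    (h : MinimalGrowth J d) :
    MinimalGrowth (Ideal.comap (rename Fin.succ :
        MvPolynomial (Fin n) K →ₐ[K] MvPolynomial (Fin (n + 1)) K) J) d := by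
  have h1 := finrank_firstVarLayer_le_lexGrowth (idealPiece_natCast_le (I := J) (d := d))
    (idealPiece_natCast_le (I := J) (d := d + 1)) mulVars_idealPiece_le h
  rwa [firstVarLayer_zero_idealPiece, firstVarLayer_zero_idealPiece] at h1

lemma finrank_idealPiece_comap_rename (J : Ideal (MvPolynomial (Fin n) K)) (e : Fin n ≃ Fin n)
    (d : ℕ) :
    Module.finrank K (idealPiece (Ideal.comap (rename e :
      MvPolynomial (Fin n) K →ₐ[K] MvPolynomial (Fin n) K) J) (d : ℤ)) =
      Module.finrank K (idealPiece J (d : ℤ)) := by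
  have h : (idealPiece (Ideal.comap (rename e :
      MvPolynomial (Fin n) K →ₐ[K] MvPolynomial (Fin n) K) J) (d : ℤ)).map
        (rename e : MvPolynomial (Fin n) K →ₐ[K] MvPolynomial (Fin n) K).toLinearMap =
      idealPiece J (d : ℤ) := by
    ext f
    rw [Submodule.mem_map]
    constructor
    · rintro ⟨g, hg, rfl⟩
      rw [mem_idealPiece_natCast] at hg ⊢
      exact ⟨hg.1, hg.2.rename_isHomogeneous⟩
    · intro hf
      rw [mem_idealPiece_natCast] at hf
      have he : rename e (rename e.symm f) = f := by simp [rename_rename]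
      refine ⟨rename e.symm f, mem_idealPiece_natCast.2 ⟨?_, hf.2.rename_isHomogeneous⟩, he⟩
      rw [Ideal.mem_comap, he]
      exact hf.1
  rw [← h]
  exact (Submodule.equivMapOfInjective _ (rename_injective e e.injective) _).finrank_eq

lemma MinimalGrowth.comap_rename_castSucc {J : Ideal (MvPolynomial (Fin (n + 1)) K)}
    (h : MinimalGrowth J d) :
    MinimalGrowth (Ideal.comap (rename Fin.castSucc :
        MvPolynomial (Fin n) K →ₐ[K] MvPolynomial (Fin (n + 1)) K) J) d := by
  set e := (finRotate (n + 1)).symm with he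
  have h1 : MinimalGrowth (Ideal.comap (rename e :
      MvPolynomial (Fin (n + 1)) K →ₐ[K] MvPolynomial (Fin (n + 1)) K) J) d := by
    unfold MinimalGrowth at h ⊢
    have h2 := finrank_idealPiece_comap_rename J e (d + 1)
    push_cast at h2
    rwa [h2, finrank_idealPiece_comap_rename J e d]
  have hcomp : (Fin.castSucc : Fin n → Fin (n + 1)) = e ∘ Fin.succ := by
    funext i
    rw [Function.comp_apply, he, Equiv.eq_symm_apply, finRotate_apply, Fin.coeSucc_eq_succ]
  have h3 := h1.comap_rename_succ
  have h4 : Ideal.comap (rename Fin.succ :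
        MvPolynomial (Fin n) K →ₐ[K] MvPolynomial (Fin (n + 1)) K) (Ideal.comap (rename e :
      MvPolynomial (Fin (n + 1)) K →ₐ[K] MvPolynomial (Fin (n + 1)) K) J) =
      Ideal.comap (rename Fin.castSucc :
        MvPolynomial (Fin n) K →ₐ[K] MvPolynomial (Fin (n + 1)) K) J := by
    ext f
    rw [Ideal.mem_comap, Ideal.mem_comap, Ideal.mem_comap, rename_rename, ← hcomp]
  rwa [h4] at h3

/-- Minimal growth passes to contractions to polynomial subrings. -/
theorem MinimalGrowth.comap_rename_castLE {ℓ : ℕ} (hnℓ : n ≤ ℓ)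
    {J : Ideal (MvPolynomial (Fin ℓ) K)} (h : MinimalGrowth J d) :
    MinimalGrowth (Ideal.comap (rename (Fin.castLE hnℓ) :
        MvPolynomial (Fin n) K →ₐ[K] MvPolynomial (Fin ℓ) K) J) d := by
  induction ℓ, hnℓ using Nat.le_induction with
  | base =>
    have : Ideal.comap (rename (Fin.castLE le_rfl) :
        MvPolynomial (Fin n) K →ₐ[K] MvPolynomial (Fin n) K) J = J := by
      ext f
      rw [Ideal.mem_comap, Fin.castLE_rfl, rename_id_apply]
    rwa [this]
  | succ ℓ hnℓ ih =>
    have h1 := ih h.comap_rename_castSucc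
    have h2 : Ideal.comap (rename (Fin.castLE hnℓ) :
        MvPolynomial (Fin n) K →ₐ[K] MvPolynomial (Fin ℓ) K) (Ideal.comap (rename Fin.castSucc :
        MvPolynomial (Fin ℓ) K →ₐ[K] MvPolynomial (Fin (ℓ + 1)) K) J) =
        Ideal.comap (rename (Fin.castLE (hnℓ.trans (Nat.le_succ ℓ))) :
        MvPolynomial (Fin n) K →ₐ[K] MvPolynomial (Fin (ℓ + 1)) K) J := by
      ext f
      rw [Ideal.mem_comap, Ideal.mem_comap, Ideal.mem_comap, rename_rename]
      rfl
    rwa [h2] at h1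

end contraction

section LexIdeal

variable {n : ℕ}

/-- The exponents of the monomials of degree `d` in the lexicographic ideal of `J`. -/
noncomputable def lexExponents (J : Ideal (MvPolynomial (Fin n) K)) (d : ℕ) :
    Finset (Fin n →₀ ℕ) :=
  lexSegment n d (Module.finrank K (idealPiece J (d : ℤ)))

variable {J : Ideal (MvPolynomial (Fin n) K)} {d : ℕ}

lemma sum_eq_of_mem_lexExponents {v : Fin n →₀ ℕ} (h : v ∈ lexExponents J d) : ∑ i, v i = d :=
  mem_exponents.1 (mem_lexSegment.1 h).1

lemma card_lexExponents (J : Ideal (MvPolynomial (Fin n) K)) (d : ℕ) :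
    (lexExponents J d).card = Module.finrank K (idealPiece J (d : ℤ)) :=
  card_lexSegment (finrank_le_card_exponents idealPiece_natCast_le)

lemma upperShadow_lexExponents_subset : upperShadow (lexExponents J d) ⊆ lexExponents J (d + 1) :=
  (isLexSegment_lexSegment _ _ _).upperShadow.subset_lexSegment
    (by exact_mod_cast lexGrowth_finrank_idealPiece_le J d)

lemma mem_lexExponents_of_le {u v : Fin n →₀ ℕ} (hu : u ∈ lexExponents J (∑ i, u i))
    (h : u ≤ v) : v ∈ lexExponents J (∑ i, v i) := by
  obtain ⟨w, rfl⟩ := le_iff_exists_add.1 h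
  clear h
  induction w using Finsupp.induction_linear generalizing u with
  | zero => rwa [add_zero]
  | add w w' hw hw' => rw [← add_assoc]; exact hw' (hw hu)
  | single t k =>
    induction k with
    | zero => rwa [Finsupp.single_zero, add_zero]
    | succ k ih =>
      rw [Finsupp.single_add, ← add_assoc, sum_add_single]
      exact upperShadow_lexExponents_subset (mem_upperShadow.2 ⟨_, ih, t, rfl⟩)

lemma lexIdeal_eq_span (J : Ideal (MvPolynomial (Fin n) K)) :
    LexIdeal J = Ideal.span
      ((fun v => monomial v (1 : K)) '' {v | v ∈ lexExponents J (∑ i, v i)}) := by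
  rw [LexIdeal]
  congr 1
  ext p
  simp only [Set.mem_ofPred_eq, Set.mem_image]
  refine exists_congr fun v => ?_
  have : {w : Fin n →₀ ℕ | ∑ i, w i = ∑ i, v i ∧ (v = w ∨ LexLT v w)} =
      lexUpper (∑ i, v i) v := by
    ext w
    rw [Finset.mem_coe, mem_lexUpper, mem_exponents]
    rfl
  rw [this, Set.ncard_coe_finset, lexExponents, mem_lexSegment, mem_exponents, eq_comm (a := p)]
  simp

lemma mem_lexIdeal {f : MvPolynomial (Fin n) K} :
    f ∈ LexIdeal J ↔ ∀ v ∈ f.support, v ∈ lexExponents J (∑ i, v i) := by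
  rw [lexIdeal_eq_span, mem_ideal_span_monomial_image]
  simp only [Set.mem_ofPred_eq]
  refine forall₂_congr fun v _ => ⟨?_, ?_⟩
  · rintro ⟨u, hu, huv⟩
    exact mem_lexExponents_of_le hu huv
  · intro hv
    exact ⟨v, hv, le_refl v⟩

lemma idealPiece_lexIdeal (J : Ideal (MvPolynomial (Fin n) K)) (d : ℕ) :
    idealPiece (LexIdeal J) (d : ℤ) =
      restrictSupport K (lexExponents J d : Set (Fin n →₀ ℕ)) := by
  ext f
  rw [mem_idealPiece_natCast, mem_lexIdeal, mem_restrictSupport_iff]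
  constructor
  · rintro ⟨h, hf⟩ v hv
    have hd : ∑ i, v i = d := by
      rw [← Finsupp.degree_eq_sum, Finsupp.degree_eq_weight_one]
      exact hf (mem_support_iff.1 hv)
    rw [← hd]
    exact h v hv
  · intro h
    refine ⟨fun v hv => ?_, fun v hv => ?_⟩
    · rw [sum_eq_of_mem_lexExponents (h hv)]
      exact h hv
    · have := sum_eq_of_mem_lexExponents (h (mem_support_iff.2 hv))
      rwa [← Finsupp.degree_eq_sum, Finsupp.degree_eq_weight_one] at this

lemma finrank_idealPiece_lexIdeal (J : Ideal (MvPolynomial (Fin n) K)) (d : ℕ) :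
    Module.finrank K (idealPiece (LexIdeal J) (d : ℤ)) =
      Module.finrank K (idealPiece J (d : ℤ)) := by
  rw [idealPiece_lexIdeal, finrank_restrictSupport, card_lexExponents]

lemma minimalGrowth_lexIdeal_iff : MinimalGrowth (LexIdeal J) d ↔ MinimalGrowth J d := by
  have h := finrank_idealPiece_lexIdeal J (d + 1)
  push_cast at h
  rw [MinimalGrowth, MinimalGrowth, h, finrank_idealPiece_lexIdeal]

lemma minimalGrowth_of_lexExponents_subset
    (h : lexExponents J (d + 1) ⊆ upperShadow (lexExponents J d)) : MinimalGrowth J d := by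
  have := Finset.card_le_card h
  rw [card_lexExponents] at this
  exact_mod_cast this

/-- If a homogeneous ideal has no generators of degree `d + 1`, its component of degree `d + 1` is
generated by the component of degree `d`. -/
lemma idealPiece_le_mulVars_of_gradedBetti_eq_zero {I : Ideal (MvPolynomial (Fin n) K)}
    (h : gradedBetti I 0 ((d : ℤ) + 1) = 0) :
    idealPiece I ((d : ℤ) + 1) ≤ mulVars (idealPiece I (d : ℤ)) := by
  intro f hf
  have h1 : LinearMap.range (koszulDiff I 0 ((d : ℤ) + 1)) = ⊤ := by
    rw [gradedBetti, koszulCycles, inf_top_eq, Nat.sub_eq_zero_iff_le] at h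
    exact Submodule.eq_of_le_of_finrank_le le_top h
  have hk : (d : ℤ) + 1 - (0 : ℕ) = d + 1 := by simp
  have hk' : (d : ℤ) + 1 - (0 + 1 : ℕ) = d := by simp
  obtain ⟨z, hz⟩ := LinearMap.range_eq_top.1 h1 fun _ => ⟨f, by rw [hk]; exact hf⟩
  have h2 := coe_koszulDiff_apply 0 _ z ⟨∅, rfl⟩
  rw [hz] at h2
  change f = _ at h2
  rw [h2, koszulMap_apply, Finset.sum_apply]
  exact Submodule.sum_mem _ fun t _ =>
    X_mul_mem_mulVars t (extContract_mem (fun s => (congrArg (idealPiece I) hk').le (extendIdx_mem z s)) t _)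

lemma minimalGrowth_of_gradedBetti_lexIdeal_eq_zero
    (h : gradedBetti (LexIdeal J) 0 ((d : ℤ) + 1) = 0) : MinimalGrowth J d := by
  have h1 := idealPiece_le_mulVars_of_gradedBetti_eq_zero h
  have h2 := idealPiece_lexIdeal J (d + 1)
  push_cast at h2
  rw [h2, idealPiece_lexIdeal, mulVars_restrictSupport] at h1
  refine minimalGrowth_of_lexExponents_subset fun v hv => ?_
  have h3 := h1 ((monomial_mem_restrictSupport (r := (1 : K)) K).2 (Or.inl hv))
  exact ((monomial_mem_restrictSupport K).1 h3).resolve_right one_ne_zero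

lemma exists_forall_minimalGrowth (J : Ideal (MvPolynomial (Fin n) K)) :
    ∃ D, ∀ d, D ≤ d → MinimalGrowth J d := by
  let c : ℕ →o Ideal (MvPolynomial (Fin n) K) :=
    { toFun := fun D => Ideal.span ((fun v => monomial v (1 : K)) ''
        {v | v ∈ lexExponents J (∑ i, v i) ∧ ∑ i, v i ≤ D})
      monotone' := fun D D' h => Ideal.span_mono (Set.image_mono fun _ hv => ⟨hv.1, hv.2.trans h⟩) }
  obtain ⟨D, hD⟩ := monotone_stabilizes_iff_noetherian.2
    (inferInstance : IsNoetherianRing (MvPolynomial (Fin n) K)) c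
  refine ⟨D, fun d hd => minimalGrowth_of_lexExponents_subset fun v hv => ?_⟩
  have hvd := sum_eq_of_mem_lexExponents hv
  have hmem : monomial v (1 : K) ∈ c D := by
    rw [hD (d + 1) (by omega)]
    exact Ideal.subset_span ⟨v, ⟨by rwa [hvd], hvd.le⟩, rfl⟩
  obtain ⟨u, ⟨hu, hud⟩, huv⟩ := mem_ideal_span_monomial_image.1 hmem v (by
    rw [mem_support_iff, coeff_monomial, if_pos rfl]
    exact one_ne_zero)
  obtain ⟨t, ht⟩ : ∃ t, u t < v t := by
    by_contra! h
    have : ∑ i, v i ≤ ∑ i, u i := Finset.sum_le_sum fun i _ => h i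
    omega
  obtain ⟨w, rfl⟩ := exists_add_single (show v t ≠ 0 by omega)
  have huw : u ≤ w := fun i => by
    by_cases hi : i = t
    · subst hi
      simpa [Nat.lt_succ_iff] using ht
    · simpa [Finsupp.single_apply, Ne.symm hi] using huv i
  rw [sum_add_single] at hvd
  have hw := mem_lexExponents_of_le hu huw
  rw [show ∑ i, w i = d by omega] at hw
  exact mem_upperShadow.2 ⟨w, hw, t, rfl⟩

lemma gradedBetti_eq_zero_of_neg {I : Ideal (MvPolynomial (Fin n) K)} {i : ℕ} {j : ℤ}
    (h : j - i < 0) : gradedBetti I i j = 0 := by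
  have : Subsingleton (idealPiece I (j - i)) := by
    rw [idealPiece_of_neg h]
    infer_instance
  rw [gradedBetti, Module.finrank_zero_of_subsingleton, Nat.zero_sub]

lemma bddAbove_reg_lexIdeal (J : Ideal (MvPolynomial (Fin n) K)) :
    BddAbove {r : ℤ | ∃ (i : ℕ) (j : ℤ), gradedBetti (LexIdeal J) i j ≠ 0 ∧ r = j - i} := by
  obtain ⟨D, hD⟩ := exists_forall_minimalGrowth J
  refine ⟨D, ?_⟩
  rintro _ ⟨i, j, hij, rfl⟩
  by_contra! hlt
  obtain ⟨d, hd⟩ := Int.le.dest hlt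
  refine hij ((minimalGrowth_lexIdeal_iff.2 (hD (D + d) (by omega))).gradedBetti_eq_zero i j ?_)
  push_cast
  omega

lemma sSup_nonneg_of_forall_nonneg {s : Set ℤ} (h : ∀ r ∈ s, 0 ≤ r) : 0 ≤ sSup s := by
  rcases s.eq_empty_or_nonempty with rfl | ⟨r, hr⟩
  · rw [Int.csSup_empty]
  · by_cases hb : BddAbove s
    · exact (h r hr).trans (le_csSup hb hr)
    · rw [Int.csSup_of_not_bddAbove hb]

lemma reg_nonneg (I : Ideal (MvPolynomial (Fin n) K)) : 0 ≤ reg I := by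
  refine sSup_nonneg_of_forall_nonneg ?_
  rintro _ ⟨i, j, hij, rfl⟩
  by_contra! hlt
  exact hij (gradedBetti_eq_zero_of_neg hlt)

end LexIdeal

/-- Let `S = K[x_1,…,x_ℓ] ⊇ R = K[x_1,…,x_n]`, let `J` be a homogeneous ideal of `S` and
`I = J ∩ R` its contraction to `R`.  Then `reg(I) ≤ reg(Lex(J))`, where `Lex(J)` is the
lexicographic ideal of `J`. -/
theorem reg_contraction_le_reg_lexIdeal {n ℓ : ℕ} (h : n ≤ ℓ)
    (J : Ideal (MvPolynomial (Fin ℓ) K)) (hJ : IsHomogeneousIdeal J) :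
    reg (Ideal.comap
        (rename (Fin.castLE h) : MvPolynomial (Fin n) K →ₐ[K] MvPolynomial (Fin ℓ) K) J) ≤
      reg (LexIdeal J) := by
  set I := Ideal.comap
    (rename (Fin.castLE h) : MvPolynomial (Fin n) K →ₐ[K] MvPolynomial (Fin ℓ) K) J with hI
  rcases Set.eq_empty_or_nonempty
    {r : ℤ | ∃ (i : ℕ) (j : ℤ), gradedBetti I i j ≠ 0 ∧ r = j - i} with hempty | hne
  · have : reg I = 0 := by
      rw [reg, hempty]
      exact Int.csSup_empty
    rw [this]
    exact reg_nonneg _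
  · refine csSup_le hne ?_
    rintro _ ⟨i, j, hij, rfl⟩
    by_contra! hlt
    have hm := reg_nonneg (LexIdeal J)
    obtain ⟨d, hd⟩ := Int.le.dest (hm.trans_lt hlt)
    have hgrowth : MinimalGrowth J d := by
      refine minimalGrowth_of_gradedBetti_lexIdeal_eq_zero ?_
      by_contra hne'
      have : (d : ℤ) + 1 ≤ reg (LexIdeal J) :=
        le_csSup (bddAbove_reg_lexIdeal J) ⟨0, d + 1, hne', by simp⟩
      omega
    exact hij ((hgrowth.comap_rename_castLE h).gradedBetti_eq_zero i j (by omega))
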